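/- arXiv:2104.12368 — 2 statements merged into one kernel-verified Lean document; each statement's English description precedes it below -/
import Mathlib

section
/- Assume sup_{x∈T} K^i(x,x) ≤ κ_i², dim(H_{K²}) < ∞, and let ξ¹,ξ² be centered Gaussian processes with covariance functions K¹,K². Let X = (x_1,…,x_m) be sampled independently from (T,ν), and W¹ = (ω¹_j)_{j=1}^N, W² = (ω²_j)_{j=1}^N be sampled independently from (Ω₁,P₁),(Ω₂,P₂). Then for every 0 < δ < 1, with probability at least 1−δ (with respect to (T,ν)^m × (Ω₁,P₁)^N × (Ω₂,P₂)^N), |W₂(N(0,(1/m)K̂¹_{W¹}[X]), N(0,(1/m)K̂²_{W²}[X])) − W₂(N(0,C_{K¹}), N(0,C_{K²}))| ≤ ( (κ_1²+κ_2²)[2log(12/δ)/m + √(2log(12/δ)/m)] + 2√2 κ_1 κ_2 √(dim H_{K²}) √(2log(12/δ)/m + √(2log(12/δ)/m)) )^{1/2} + 3(κ_1+κ_2) √( 16/(Nδ²) + (2√m/(√N δ))(3 + 8/(√N δ)) ). -/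
open MeasureTheory ProbabilityTheory
open scoped RealInnerProductSpace

noncomputable section

section LinearAlgebra

variable {E F D : Type*} [NormedAddCommGroup E] [InnerProductSpace ℝ E]
  [NormedAddCommGroup F] [InnerProductSpace ℝ F]
  [NormedAddCommGroup D] [InnerProductSpace ℝ D]

/-- Bessel's inequality for a pairwise orthogonal family of vectors of norm at most one. -/
theorem sum_inner_sq_le_of_orthogonal {ι : Type*} [Fintype ι] (w : ι → F)
    (hw : Pairwise fun i j => ⟪w i, w j⟫ = 0) (hn : ∀ i, ‖w i‖ ≤ 1) (x : F) :
    ∑ i, ⟪w i, x⟫ ^ 2 ≤ ‖x‖ ^ 2 := by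
  classical
  set y : F := ∑ i, ⟪w i, x⟫ • w i with hy
  set S := ∑ i, ⟪w i, x⟫ ^ 2 with hS
  have h1 : ⟪y, x⟫ = S := by
    simp only [hy, hS, sum_inner, real_inner_smul_left, sq]
  have h2 : ‖y‖ ^ 2 ≤ S := by
    rw [← real_inner_self_eq_norm_sq]
    simp only [hy, hS, sum_inner, inner_sum, real_inner_smul_left, real_inner_smul_right]
    refine Finset.sum_le_sum fun i _ => ?_
    rw [Finset.sum_eq_single i]
    · rw [real_inner_self_eq_norm_sq]
      have : ‖w i‖ ^ 2 ≤ 1 := by nlinarith [hn i, norm_nonneg (w i)]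
      nlinarith [sq_nonneg ⟪w i, x⟫]
    · intro j _ hj
      rw [hw hj]
      simp
    · simp
  have h3 : S ≤ ‖y‖ * ‖x‖ := h1 ▸ real_inner_le_norm y x
  have hS0 : 0 ≤ S := Finset.sum_nonneg fun i _ => sq_nonneg _
  by_contra! hlt
  have hSpos : 0 < S := lt_of_le_of_lt (sq_nonneg _) hlt
  have h4 : S ^ 2 ≤ S * ‖x‖ ^ 2 := by
    calc S ^ 2 ≤ (‖y‖ * ‖x‖) ^ 2 := by gcongr
      _ = ‖y‖ ^ 2 * ‖x‖ ^ 2 := by ring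
      _ ≤ S * ‖x‖ ^ 2 := by gcongr
  nlinarith

/-- The sum of squared norms of the images of an orthonormal basis does not depend on the basis. -/
theorem sum_norm_sq_map_orthonormalBasis {ι κ : Type*} [Fintype ι] [Fintype κ] (T : D →ₗ[ℝ] F)
    (e : OrthonormalBasis ι ℝ D) (f : OrthonormalBasis κ ℝ D) :
    ∑ i, ‖T (f i)‖ ^ 2 = ∑ j, ‖T (e j)‖ ^ 2 := by
  classical
  have h (i) : ‖T (f i)‖ ^ 2 = ∑ j, ∑ k, ⟪e j, f i⟫ * ⟪f i, e k⟫ * ⟪T (e j), T (e k)⟫ := by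
    rw [← real_inner_self_eq_norm_sq]
    conv_lhs => rw [← e.sum_repr' (f i)]
    simp only [map_sum, map_smul, sum_inner, inner_sum, real_inner_smul_left,
      real_inner_smul_right]
    refine Finset.sum_congr rfl fun j _ => Finset.sum_congr rfl fun k _ => ?_
    rw [real_inner_comm (f i) (e k)]
    rw [real_inner_comm (T (e j)) (T (e k))]
    ring
  simp only [h]
  rw [Finset.sum_comm]
  refine Finset.sum_congr rfl fun j _ => ?_
  rw [Finset.sum_comm]
  simp only [← Finset.sum_mul, f.sum_inner_mul_inner]
  rw [Finset.sum_eq_single j]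
  · simp
  · intro k _ hk
    rw [e.inner_eq_zero hk.symm, zero_mul]
  · simp

/-- Every linear map out of a finite-dimensional space maps some orthonormal basis to a pairwise
orthogonal family (singular value decomposition). -/
theorem exists_orthonormalBasis_map_orthogonal [FiniteDimensional ℝ D] {n : ℕ}
    (hn : Module.finrank ℝ D = n) (T : D →ₗ[ℝ] F) :
    ∃ f : OrthonormalBasis (Fin n) ℝ D, Pairwise fun i j => ⟪T (f i), T (f j)⟫ = 0 := by
  let R := T.rangeRestrict
  have hs : (R.adjoint ∘ₗ R).IsSymmetric := by
    intro x y
    simp [LinearMap.adjoint_inner_left, LinearMap.adjoint_inner_right]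
  refine ⟨hs.eigenvectorBasis hn, fun i j hij => ?_⟩
  have h : ⟪T (hs.eigenvectorBasis hn i), T (hs.eigenvectorBasis hn j)⟫ =
      ⟪(R.adjoint ∘ₗ R) (hs.eigenvectorBasis hn i), hs.eigenvectorBasis hn j⟫ := by
    rw [LinearMap.comp_apply, LinearMap.adjoint_inner_left]
    rfl
  refine h.trans ?_
  rw [hs.apply_eigenvectorBasis, inner_smul_left,
    (hs.eigenvectorBasis hn).inner_eq_zero hij, mul_zero]

/-- Duality bound for the trace norm. -/
theorem sum_inner_map_le_sum_norm_map {ι κ : Type*} [Fintype ι] [Fintype κ] (T : D →ₗ[ℝ] F)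
    (f : OrthonormalBasis ι ℝ D) (g : OrthonormalBasis κ ℝ D)
    (w : κ → F) (hw : Pairwise fun i j => ⟪w i, w j⟫ = 0) (hn : ∀ i, ‖w i‖ ≤ 1) :
    ∑ i, ⟪w i, T (g i)⟫ ≤ ∑ j, ‖T (f j)‖ := by
  have h (i) : ⟪w i, T (g i)⟫ = ∑ j, ⟪f j, g i⟫ * ⟪w i, T (f j)⟫ := by
    conv_lhs => rw [← f.sum_repr' (g i)]
    simp only [map_sum, map_smul, inner_sum, real_inner_smul_right]
  simp only [h]
  rw [Finset.sum_comm]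
  refine Finset.sum_le_sum fun j _ => ?_
  refine (Real.sum_mul_le_sqrt_mul_sqrt _ _ _).trans ?_
  have h1 : ∑ i, ⟪f j, g i⟫ ^ 2 = 1 := by
    have := g.sum_inner_mul_inner (f j) (f j)
    simp only [real_inner_self_eq_norm_sq, f.norm_eq_one] at this
    rw [← one_pow 2, ← this]
    refine Finset.sum_congr rfl fun i _ => ?_
    rw [real_inner_comm (f j) (g i), sq]
  rw [h1, Real.sqrt_one, one_mul]
  exact Real.sqrt_le_iff.2 ⟨norm_nonneg _, sum_inner_sq_le_of_orthogonal w hw hn _⟩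

theorem inner_inv_norm_smul_self (x : F) : ⟪‖x‖⁻¹ • x, x⟫ = ‖x‖ := by
  rw [real_inner_smul_left, real_inner_self_eq_norm_sq]
  rcases eq_or_ne ‖x‖ 0 with h | h
  · simp [h]
  · field_simp

theorem norm_inv_norm_smul_le (x : F) : ‖‖x‖⁻¹ • x‖ ≤ 1 := by
  rw [norm_smul, norm_inv, norm_norm]
  exact inv_mul_le_one

/-- The trace norm is Lipschitz with respect to the Hilbert–Schmidt norm. -/
theorem sum_norm_map_sub_le {ι : Type*} [Fintype ι] (T T' : D →ₗ[ℝ] F)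
    (e f f' : OrthonormalBasis ι ℝ D)
    (hf : Pairwise fun i j => ⟪T (f i), T (f j)⟫ = 0) :
    ∑ i, ‖T (f i)‖ - ∑ i, ‖T' (f' i)‖ ≤
      √(Fintype.card ι) * √(∑ i, ‖(T - T') (e i)‖ ^ 2) := by
  set w : ι → F := fun i => ‖T (f i)‖⁻¹ • T (f i)
  have hw : Pairwise fun i j => ⟪w i, w j⟫ = 0 := fun i j hij => by
    simp only [w, real_inner_smul_left, real_inner_smul_right, hf hij, mul_zero]
  have hn (i) : ‖w i‖ ≤ 1 := norm_inv_norm_smul_le _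
  have h1 := sum_inner_map_le_sum_norm_map T' f' f w hw hn
  have h2 : ∑ i, ‖T (f i)‖ - ∑ i, ⟪w i, T' (f i)⟫ ≤ ∑ i, 1 * ‖(T - T') (f i)‖ := by
    rw [← Finset.sum_sub_distrib]
    refine Finset.sum_le_sum fun i _ => ?_
    calc ‖T (f i)‖ - ⟪w i, T' (f i)⟫ = ⟪w i, (T - T') (f i)⟫ := by
          rw [LinearMap.sub_apply, inner_sub_right, inner_inv_norm_smul_self]
      _ ≤ ‖w i‖ * ‖(T - T') (f i)‖ := real_inner_le_norm _ _
      _ ≤ 1 * ‖(T - T') (f i)‖ := by gcongr; exact hn i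
  have h3 := Real.sum_mul_le_sqrt_mul_sqrt Finset.univ (fun _ : ι => (1 : ℝ))
    (fun i => ‖(T - T') (f i)‖)
  rw [sum_norm_sq_map_orthonormalBasis (T - T') e f] at h3
  simp only [one_pow, Finset.sum_const, Finset.card_univ, nsmul_eq_mul, mul_one] at h3
  linarith

/-- A symmetric operator that is positive has an eigenvalue `s` at every eigenvector of its square
with eigenvalue `s ^ 2`. -/
theorem apply_eq_smul_of_apply_apply_eq (S : E →ₗ[ℝ] E) (hpos : ∀ x, 0 ≤ ⟪S x, x⟫) {s : ℝ}
    (hs : 0 < s) {v : E} (hv : S (S v) = (s ^ 2) • v) : S v = s • v := by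
  have h : S (S v - s • v) = -(s • (S v - s • v)) := by
    rw [map_sub, map_smul, hv, smul_sub, smul_smul, sq]
    abel
  have h2 := hpos (S v - s • v)
  rw [h, inner_neg_left, real_inner_smul_left, real_inner_self_eq_norm_sq] at h2
  have h3 : ‖S v - s • v‖ ^ 2 ≤ 0 := by nlinarith
  have h4 : ‖S v - s • v‖ = 0 := sq_eq_zero_iff.1 (le_antisymm h3 (sq_nonneg _))
  exact sub_eq_zero.1 (norm_eq_zero.1 h4)

/-- The trace of the positive square root of `∑ i, w i ⊗ w i` for an orthogonal family `w`. -/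
theorem hasSum_inner_sqrt_of_orthogonal {ι κ : Type*} [Fintype κ] (e : HilbertBasis ι ℝ E)
    (S : E →ₗ[ℝ] E) (hsymm : S.IsSymmetric) (hpos : ∀ x, 0 ≤ ⟪S x, x⟫)
    (w : κ → E) (hw : Pairwise fun i j => ⟪w i, w j⟫ = 0)
    (hS : ∀ x, S (S x) = ∑ i, ⟪w i, x⟫ • w i) :
    HasSum (fun k => ⟪e k, S (e k)⟫) (∑ i, ‖w i‖) := by
  classical
  have hSS (i) : S (S (w i)) = (‖w i‖ ^ 2) • w i := by
    rw [hS, Finset.sum_eq_single i, real_inner_self_eq_norm_sq]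
    · intro j _ hj
      rw [hw hj, zero_smul]
    · simp
  have hSw (i) : S (w i) = ‖w i‖ • w i := by
    rcases eq_or_ne (w i) 0 with h | h
    · simp [h]
    · exact apply_eq_smul_of_apply_apply_eq S hpos (norm_pos_iff.2 h) (hSS i)
  have hker (r : E) (hr : ∀ i, ⟪w i, r⟫ = 0) : S r = 0 := by
    have h : ⟪S r, S r⟫ = 0 := by
      rw [hsymm, hS]
      simp [hr]
    exact inner_self_eq_zero.1 h
  have hSx (x : E) : S x = ∑ i, (‖w i‖⁻¹ * ⟪w i, x⟫) • w i := by
    have h0 : S (x - ∑ i, ((‖w i‖ ^ 2)⁻¹ * ⟪w i, x⟫) • w i) = 0 := by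
      refine hker _ fun j => ?_
      rw [inner_sub_right, inner_sum, Finset.sum_eq_single j]
      · rw [real_inner_smul_right, real_inner_self_eq_norm_sq]
        rcases eq_or_ne (w j) 0 with h | h
        · simp [h]
        · have := norm_pos_iff.2 h
          field_simp
          ring
      · intro i _ hi
        rw [real_inner_smul_right, hw hi.symm, mul_zero]
      · simp
    rw [map_sub, sub_eq_zero, map_sum] at h0
    rw [h0]
    refine Finset.sum_congr rfl fun i _ => ?_
    rw [map_smul, hSw, smul_smul]
    congr 1
    rcases eq_or_ne (w i) 0 with h | h
    · simp [h]
    · have := norm_pos_iff.2 h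
      field_simp
  have hk (k) : ⟪e k, S (e k)⟫ = ∑ i, ‖w i‖⁻¹ * (⟪w i, e k⟫ * ⟪e k, w i⟫) := by
    rw [hSx, inner_sum]
    refine Finset.sum_congr rfl fun i _ => ?_
    rw [real_inner_smul_right, mul_assoc]
  simp only [hk]
  refine hasSum_sum fun i _ => ?_
  have h := (e.hasSum_inner_mul_inner (w i) (w i)).mul_left ‖w i‖⁻¹
  rwa [← real_inner_smul_left, inner_inv_norm_smul_self] at h

/-- The trace of the positive square root of `Q B Q` with `Q ^ 2 = A` and `B = ∑ i, β i ⊗ β i`,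
where the `β i` are `A`-orthogonal. -/
theorem hasSum_inner_sqrt_conj {ι κ : Type*} [Fintype κ] (e : HilbertBasis ι ℝ E)
    (Q A B M : E →ₗ[ℝ] E) (hQ : Q.IsSymmetric) (hQQ : ∀ x, Q (Q x) = A x)
    (hM : M.IsSymmetric) (hpos : ∀ x, 0 ≤ ⟪M x, x⟫) (hMM : ∀ x, M (M x) = Q (B (Q x)))
    (β : κ → E) (hB : ∀ x, B x = ∑ i, ⟪β i, x⟫ • β i)
    (hβ : Pairwise fun i j => ⟪β i, A (β j)⟫ = 0) :
    HasSum (fun k => ⟪e k, M (e k)⟫) (∑ i, √⟪β i, A (β i)⟫) := by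
  have hQi (i j) : ⟪Q (β i), Q (β j)⟫ = ⟪β i, A (β j)⟫ := by rw [hQ, hQQ]
  convert hasSum_inner_sqrt_of_orthogonal e M hM hpos (fun i => Q (β i))
    (fun i j hij => (hQi i j).trans (hβ hij)) (fun x => ?_) using 1
  · refine Finset.sum_congr rfl fun i _ => ?_
    rw [← hQi, real_inner_self_eq_norm_sq, Real.sqrt_sq (norm_nonneg _)]
  · rw [hMM, hB, map_sum]
    refine Finset.sum_congr rfl fun i _ => ?_
    rw [map_smul, hQ]

/-- Powers–Størmer inequality in Hilbert–Schmidt form. -/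
theorem sum_norm_sq_sub_le {ι : Type*} [Fintype ι] (e : OrthonormalBasis ι ℝ E)
    (S R : E →ₗ[ℝ] E) (hS : S.IsSymmetric) (hR : R.IsSymmetric)
    (hSpos : ∀ x, 0 ≤ ⟪S x, x⟫) (hRpos : ∀ x, 0 ≤ ⟪R x, x⟫) :
    ∑ i, ‖(S - R) (e i)‖ ^ 2 ≤
      √(Fintype.card ι) * √(∑ i, ‖(S ∘ₗ S - R ∘ₗ R) (e i)‖ ^ 2) := by
  have : FiniteDimensional ℝ E := e.toBasis.finiteDimensional_of_finite
  have hD : (S - R).IsSymmetric := hS.sub hR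
  set n := Module.finrank ℝ E with hn
  let u := hD.eigenvectorBasis hn.symm
  let d := hD.eigenvalues hn.symm
  have hu (i) : (S - R) (u i) = d i • u i := hD.apply_eigenvectorBasis hn.symm i
  have hcard : Fintype.card ι = n := (Module.finrank_eq_card_basis e.toBasis).symm
  have key (i) : ‖(S - R) (u i)‖ ^ 2 ≤ 1 * ‖(S ∘ₗ S - R ∘ₗ R) (u i)‖ := by
    have hui : ⟪u i, u i⟫ = 1 := by
      rw [real_inner_self_eq_norm_sq, u.norm_eq_one, one_pow]
    have h1 : ‖(S - R) (u i)‖ ^ 2 = d i ^ 2 := by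
      rw [hu, norm_smul, u.norm_eq_one, mul_one, Real.norm_eq_abs, sq_abs]
    have hd : d i = ⟪S (u i), u i⟫ - ⟪R (u i), u i⟫ := by
      rw [← inner_sub_left, ← LinearMap.sub_apply, hu, real_inner_smul_left, hui, mul_one]
    have h2 : ⟪(S ∘ₗ S - R ∘ₗ R) (u i), u i⟫ = d i * (⟪S (u i), u i⟫ + ⟪R (u i), u i⟫) := by
      have h3 : ⟪S (u i), S (u i)⟫ - ⟪R (u i), R (u i)⟫ =
          ⟪(S - R) (u i), S (u i)⟫ + ⟪(S - R) (u i), R (u i)⟫ := by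
        rw [LinearMap.sub_apply, inner_sub_left, inner_sub_left,
          real_inner_comm (R (u i)) (S (u i))]
        ring
      rw [LinearMap.sub_apply, LinearMap.comp_apply, LinearMap.comp_apply, inner_sub_left, hS, hR,
        h3, hu, real_inner_smul_left, real_inner_smul_left, real_inner_comm, real_inner_comm (R (u i))]
      ring
    have h3 : |⟪(S ∘ₗ S - R ∘ₗ R) (u i), u i⟫| ≤ ‖(S ∘ₗ S - R ∘ₗ R) (u i)‖ := by
      simpa [u.norm_eq_one] using abs_real_inner_le_norm ((S ∘ₗ S - R ∘ₗ R) (u i)) (u i)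
    rw [h1, one_mul]
    refine le_trans ?_ h3
    rw [h2, abs_mul, abs_of_nonneg (add_nonneg (hSpos _) (hRpos _)), ← sq_abs, sq]
    refine mul_le_mul_of_nonneg_left ?_ (abs_nonneg _)
    have := hSpos (u i)
    have := hRpos (u i)
    rw [hd, abs_le]
    constructor <;> linarith
  calc ∑ i, ‖(S - R) (e i)‖ ^ 2 = ∑ i, ‖(S - R) (u i)‖ ^ 2 :=
        (sum_norm_sq_map_orthonormalBasis _ _ _).symm
    _ ≤ ∑ i, 1 * ‖(S ∘ₗ S - R ∘ₗ R) (u i)‖ := Finset.sum_le_sum fun i _ => key i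
    _ ≤ √(∑ i : Fin n, (1 : ℝ) ^ 2) * √(∑ i, ‖(S ∘ₗ S - R ∘ₗ R) (u i)‖ ^ 2) :=
        Real.sum_mul_le_sqrt_mul_sqrt _ _ _
    _ = _ := by
        rw [sum_norm_sq_map_orthonormalBasis _ e u, hcard]
        simp

end LinearAlgebra
section Procrustes

theorem sqrt_sum_norm_sq_add_le {V ι : Type*} [SeminormedAddCommGroup V] [Fintype ι]
    (a b : ι → V) :
    √(∑ i, ‖a i + b i‖ ^ 2) ≤ √(∑ i, ‖a i‖ ^ 2) + √(∑ i, ‖b i‖ ^ 2) := by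
  have h := norm_add_le (WithLp.toLp 2 a : PiLp 2 fun _ : ι => V) (WithLp.toLp 2 b)
  simpa only [PiLp.norm_eq_of_L2, PiLp.add_apply] using h

variable {E : Type*} [NormedAddCommGroup E] [InnerProductSpace ℝ E]

/-- The Bures–Wasserstein distance is attained at a pair of orthonormal bases. -/
theorem exists_orthonormalBasis_sum_norm_sq_sub {ι : Type*} [Fintype ι]
    (e f : OrthonormalBasis ι ℝ E) (S₁ S₂ : E →ₗ[ℝ] E) (hS₁ : S₁.IsSymmetric)
    (hf : Pairwise fun i j => ⟪S₁ (S₂ (f i)), S₁ (S₂ (f j))⟫ = 0) :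
    ∃ w : OrthonormalBasis ι ℝ E, ∑ i, ‖S₁ (w i) - S₂ (f i)‖ ^ 2 =
      ∑ i, ‖S₁ (e i)‖ ^ 2 + ∑ i, ‖S₂ (e i)‖ ^ 2 - 2 * ∑ i, ‖S₁ (S₂ (f i))‖ := by
  have : FiniteDimensional ℝ E := e.toBasis.finiteDimensional_of_finite
  let v : ι → E := fun i => ‖S₁ (S₂ (f i))‖⁻¹ • S₁ (S₂ (f i))
  let s : Set ι := {i | S₁ (S₂ (f i)) ≠ 0}
  have hv : Orthonormal ℝ (s.domRestrict v) := by
    constructor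
    · rintro ⟨i, hi⟩
      simp only [Set.domRestrict_apply, v]
      rw [norm_smul, norm_inv, norm_norm]
      exact inv_mul_cancel₀ (norm_ne_zero_iff.2 hi)
    · rintro ⟨i, hi⟩ ⟨j, hj⟩ hij
      have : i ≠ j := fun h => hij (Subtype.ext h)
      simp only [Set.domRestrict_apply, v, real_inner_smul_left, real_inner_smul_right, hf this,
        mul_zero]
  obtain ⟨w, hw⟩ := hv.exists_orthonormalBasis_extension_of_card_eq
    (Module.finrank_eq_card_basis e.toBasis)
  refine ⟨w, ?_⟩
  have h1 (i) : ⟪w i, S₁ (S₂ (f i))⟫ = ‖S₁ (S₂ (f i))‖ := by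
    by_cases hi : S₁ (S₂ (f i)) = 0
    · simp [hi]
    · rw [hw i hi]
      exact inner_inv_norm_smul_self _
  rw [← sum_norm_sq_map_orthonormalBasis S₁ e w, ← sum_norm_sq_map_orthonormalBasis S₂ e f,
    Finset.mul_sum, ← Finset.sum_add_distrib, ← Finset.sum_sub_distrib]
  refine Finset.sum_congr rfl fun i _ => ?_
  rw [norm_sub_sq_real, hS₁, h1]
  ring

/-- The Bures–Wasserstein distance, as a function of the square roots, is Lipschitz for the
Hilbert–Schmidt norm. -/
theorem sqrt_bures_le_add {ι : Type*} [Fintype ι] (e f f' : OrthonormalBasis ι ℝ E)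
    (S₁ S₂ S₁' S₂' : E →ₗ[ℝ] E) (hS₁ : S₁.IsSymmetric) (hS₁' : S₁'.IsSymmetric)
    (hf : Pairwise fun i j => ⟪S₁ (S₂ (f i)), S₁ (S₂ (f j))⟫ = 0) :
    √(∑ i, ‖S₁' (e i)‖ ^ 2 + ∑ i, ‖S₂' (e i)‖ ^ 2 - 2 * ∑ i, ‖S₁' (S₂' (f' i))‖) ≤
      √(∑ i, ‖S₁ (e i)‖ ^ 2 + ∑ i, ‖S₂ (e i)‖ ^ 2 - 2 * ∑ i, ‖S₁ (S₂ (f i))‖) +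
        (√(∑ i, ‖(S₁' - S₁) (e i)‖ ^ 2) + √(∑ i, ‖(S₂ - S₂') (e i)‖ ^ 2)) := by
  obtain ⟨w, hw⟩ := exists_orthonormalBasis_sum_norm_sq_sub e f S₁ S₂ hS₁ hf
  have h1 : ∑ i, ‖S₁' (e i)‖ ^ 2 + ∑ i, ‖S₂' (e i)‖ ^ 2 - 2 * ∑ i, ‖S₁' (S₂' (f' i))‖ ≤
      ∑ i, ‖S₁' (w i) - S₂' (f i)‖ ^ 2 := by
    have h2 := sum_inner_map_le_sum_norm_map (S₁' ∘ₗ S₂') f' f w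
      (fun i j hij => w.inner_eq_zero hij) (fun i => (w.norm_eq_one i).le)
    simp only [LinearMap.comp_apply] at h2
    rw [← sum_norm_sq_map_orthonormalBasis S₁' e w, ← sum_norm_sq_map_orthonormalBasis S₂' e f]
    have h3 (i) : ‖S₁' (w i) - S₂' (f i)‖ ^ 2 =
        ‖S₁' (w i)‖ ^ 2 + ‖S₂' (f i)‖ ^ 2 - 2 * ⟪w i, S₁' (S₂' (f i))⟫ := by
      rw [norm_sub_sq_real, hS₁']
      ring
    simp only [h3, Finset.sum_sub_distrib, Finset.sum_add_distrib, ← Finset.mul_sum]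
    linarith
  refine (Real.sqrt_le_sqrt h1).trans ?_
  rw [← hw, ← sum_norm_sq_map_orthonormalBasis (S₁' - S₁) e w,
    ← sum_norm_sq_map_orthonormalBasis (S₂ - S₂') e f]
  have h4 (i) : S₁' (w i) - S₂' (f i) =
      (S₁ (w i) - S₂ (f i)) + ((S₁' - S₁) (w i) + (S₂ - S₂') (f i)) := by
    simp only [LinearMap.sub_apply]
    abel
  simp only [h4]
  refine (sqrt_sum_norm_sq_add_le _ _).trans ?_
  gcongr
  exact sqrt_sum_norm_sq_add_le _ _

/-- The trace of the positive square root of `S₁ S₂² S₁` is the trace norm of `S₁ S₂`. -/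
theorem sum_inner_sqrt_conj_eq {ι : Type*} [Fintype ι] (e f : OrthonormalBasis ι ℝ E)
    (S₁ S₂ M : E →ₗ[ℝ] E) (hS₁ : S₁.IsSymmetric) (hS₂ : S₂.IsSymmetric)
    (hM : M.IsSymmetric) (hpos : ∀ x, 0 ≤ ⟪M x, x⟫)
    (hMM : ∀ x, M (M x) = S₁ (S₂ (S₂ (S₁ x))))
    (hf : Pairwise fun i j => ⟪S₁ (S₂ (f i)), S₁ (S₂ (f j))⟫ = 0) :
    ∑ k, ⟪e k, M (e k)⟫ = ∑ i, ‖S₁ (S₂ (f i))‖ := by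
  have : FiniteDimensional ℝ E := e.toBasis.finiteDimensional_of_finite
  have : CompleteSpace E := FiniteDimensional.complete ℝ E
  have h (i j) : ⟪S₂ (f i), (S₁ ∘ₗ S₁) (S₂ (f j))⟫ = ⟪S₁ (S₂ (f i)), S₁ (S₂ (f j))⟫ :=
    (hS₁ _ _).symm
  have h1 := hasSum_inner_sqrt_conj e.toHilbertBasis S₁ (S₁ ∘ₗ S₁) (S₂ ∘ₗ S₂) M hS₁
    (fun _ => rfl) hM hpos hMM (fun i => S₂ (f i)) (fun x => ?_)
    (fun i j hij => (h i j).trans (hf hij))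
  · simp only [h, real_inner_self_eq_norm_sq, Real.sqrt_sq (norm_nonneg _),
      OrthonormalBasis.coe_toHilbertBasis] at h1
    exact (hasSum_fintype _).unique h1
  · rw [LinearMap.comp_apply]
    conv_lhs => rw [← f.sum_repr' (S₂ x)]
    simp only [map_sum, map_smul, hS₂ (f _) x]

end Procrustes

section Matrices

variable {m : ℕ}

theorem inner_basisFun_toEuclideanLin (A : Matrix (Fin m) (Fin m) ℝ) (i j : Fin m) :
    ⟪EuclideanSpace.basisFun (Fin m) ℝ i, A.toEuclideanLin (EuclideanSpace.basisFun (Fin m) ℝ j)⟫ =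
      A i j := by
  simp [Matrix.toLpLin_apply, EuclideanSpace.inner_single_left]

theorem sum_inner_basisFun_toEuclideanLin (A : Matrix (Fin m) (Fin m) ℝ) :
    ∑ i, ⟪EuclideanSpace.basisFun (Fin m) ℝ i,
      A.toEuclideanLin (EuclideanSpace.basisFun (Fin m) ℝ i)⟫ = A.trace := by
  simp only [inner_basisFun_toEuclideanLin]
  rfl

theorem sum_norm_sq_toEuclideanLin_basisFun (A : Matrix (Fin m) (Fin m) ℝ) :
    ∑ i, ‖A.toEuclideanLin (EuclideanSpace.basisFun (Fin m) ℝ i)‖ ^ 2 = ∑ i, ∑ j, A i j ^ 2 := by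
  rw [Finset.sum_comm]
  refine Finset.sum_congr rfl fun j _ => ?_
  rw [EuclideanSpace.norm_sq_eq]
  refine Finset.sum_congr rfl fun i _ => ?_
  simp [Matrix.toLpLin_apply]

theorem toEuclideanLin_mul_apply (A B : Matrix (Fin m) (Fin m) ℝ) (x : EuclideanSpace ℝ (Fin m)) :
    (A * B).toEuclideanLin x = A.toEuclideanLin (B.toEuclideanLin x) := by
  simp [Matrix.toLpLin_apply, Matrix.mulVec_mulVec]

theorem Matrix.PosSemidef.toEuclideanLin_isSymmetric {A : Matrix (Fin m) (Fin m) ℝ}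
    (hA : A.PosSemidef) : A.toEuclideanLin.IsSymmetric :=
  (Matrix.isPositive_toEuclideanLin_iff.2 hA).isSymmetric

theorem Matrix.PosSemidef.inner_toEuclideanLin_nonneg {A : Matrix (Fin m) (Fin m) ℝ}
    (hA : A.PosSemidef) (x : EuclideanSpace ℝ (Fin m)) : 0 ≤ ⟪A.toEuclideanLin x, x⟫ := by
  simpa using (Matrix.isPositive_toEuclideanLin_iff.2 hA).2 x

theorem Matrix.PosSemidef.exists_sq_eq {A : Matrix (Fin m) (Fin m) ℝ}
    (hA : A.PosSemidef) : ∃ S : Matrix (Fin m) (Fin m) ℝ, S.PosSemidef ∧ S * S = A := by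
  open scoped MatrixOrder in
  exact ⟨CFC.sqrt A, Matrix.nonneg_iff_posSemidef.1 (CFC.sqrt_nonneg A),
    CFC.sqrt_mul_sqrt_self A hA.nonneg⟩

theorem trace_eq_sum_norm_sq_sqrt {A S : Matrix (Fin m) (Fin m) ℝ} (hS : S.PosSemidef)
    (hSS : S * S = A) :
    A.trace = ∑ i, ‖S.toEuclideanLin (EuclideanSpace.basisFun (Fin m) ℝ i)‖ ^ 2 := by
  rw [← sum_inner_basisFun_toEuclideanLin, ← hSS]
  refine Finset.sum_congr rfl fun i _ => ?_
  rw [toEuclideanLin_mul_apply, ← hS.toEuclideanLin_isSymmetric, real_inner_self_eq_norm_sq]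

/-- Frobenius norm bound on the difference of positive semidefinite square roots. -/
theorem sqrt_sum_norm_sq_sqrt_sub_le {A A' S S' : Matrix (Fin m) (Fin m) ℝ} (hS : S.PosSemidef)
    (hS' : S'.PosSemidef) (hSS : S * S = A) (hSS' : S' * S' = A') :
    √(∑ i, ‖(S.toEuclideanLin - S'.toEuclideanLin) (EuclideanSpace.basisFun (Fin m) ℝ i)‖ ^ 2) ≤
      √(√m * √(∑ i, ∑ j, (A - A') i j ^ 2)) := by
  refine Real.sqrt_le_sqrt ?_
  have h := sum_norm_sq_sub_le (EuclideanSpace.basisFun (Fin m) ℝ) S.toEuclideanLin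
    S'.toEuclideanLin hS.toEuclideanLin_isSymmetric hS'.toEuclideanLin_isSymmetric
    hS.inner_toEuclideanLin_nonneg hS'.inner_toEuclideanLin_nonneg
  have h2 : S.toEuclideanLin ∘ₗ S.toEuclideanLin - S'.toEuclideanLin ∘ₗ S'.toEuclideanLin =
      (A - A').toEuclideanLin := by
    ext1 x
    rw [map_sub, ← hSS, ← hSS', LinearMap.sub_apply, LinearMap.sub_apply,
      toEuclideanLin_mul_apply, toEuclideanLin_mul_apply]
    rfl
  rwa [h2, sum_norm_sq_toEuclideanLin_basisFun, Fintype.card_fin] at h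

theorem trace_sqrt_conj_eq {S₁ S₂ B M : Matrix (Fin m) (Fin m) ℝ} (hS₁ : S₁.PosSemidef)
    (hS₂ : S₂.PosSemidef) (hB : S₂ * S₂ = B) (hM : M.PosSemidef) (hMM : M * M = S₁ * B * S₁)
    (f : OrthonormalBasis (Fin m) ℝ (EuclideanSpace ℝ (Fin m)))
    (hf : Pairwise fun i j => ⟪S₁.toEuclideanLin (S₂.toEuclideanLin (f i)),
      S₁.toEuclideanLin (S₂.toEuclideanLin (f j))⟫ = 0) :
    M.trace = ∑ i, ‖S₁.toEuclideanLin (S₂.toEuclideanLin (f i))‖ := by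
  rw [← sum_inner_basisFun_toEuclideanLin]
  refine sum_inner_sqrt_conj_eq _ f _ _ _ hS₁.toEuclideanLin_isSymmetric
    hS₂.toEuclideanLin_isSymmetric hM.toEuclideanLin_isSymmetric
    hM.inner_toEuclideanLin_nonneg (fun x => ?_) hf
  rw [← toEuclideanLin_mul_apply, hMM, ← hB]
  simp only [toEuclideanLin_mul_apply]

theorem exists_orthonormalBasis_conj_orthogonal (S₁ S₂ : Matrix (Fin m) (Fin m) ℝ) :
    ∃ f : OrthonormalBasis (Fin m) ℝ (EuclideanSpace ℝ (Fin m)),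
      Pairwise fun i j => ⟪S₁.toEuclideanLin (S₂.toEuclideanLin (f i)),
        S₁.toEuclideanLin (S₂.toEuclideanLin (f j))⟫ = 0 :=
  exists_orthonormalBasis_map_orthogonal finrank_euclideanSpace_fin
    (S₁.toEuclideanLin ∘ₗ S₂.toEuclideanLin)

/-- Stability of the Bures–Wasserstein distance between positive semidefinite matrices. -/
theorem abs_sqrt_bures_sub_le {A B A' B' Q Q' M M' : Matrix (Fin m) (Fin m) ℝ}
    (hB : B.PosSemidef) (hB' : B'.PosSemidef)
    (hQ : Q.PosSemidef) (hQQ : Q * Q = A) (hM : M.PosSemidef) (hMM : M * M = Q * B * Q)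
    (hQ' : Q'.PosSemidef) (hQQ' : Q' * Q' = A') (hM' : M'.PosSemidef)
    (hMM' : M' * M' = Q' * B' * Q') :
    |√(A.trace + B.trace - 2 * M.trace) - √(A'.trace + B'.trace - 2 * M'.trace)| ≤
      √(√m * √(∑ i, ∑ j, (A - A') i j ^ 2)) + √(√m * √(∑ i, ∑ j, (B - B') i j ^ 2)) := by
  obtain ⟨S, hS, hSS⟩ := hB.exists_sq_eq
  obtain ⟨S', hS', hSS'⟩ := hB'.exists_sq_eq
  obtain ⟨f, hf⟩ := exists_orthonormalBasis_conj_orthogonal Q S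
  obtain ⟨f', hf'⟩ := exists_orthonormalBasis_conj_orthogonal Q' S'
  rw [trace_sqrt_conj_eq hQ hS hSS hM hMM f hf, trace_sqrt_conj_eq hQ' hS' hSS' hM' hMM' f' hf',
    trace_eq_sum_norm_sq_sqrt hQ hQQ, trace_eq_sum_norm_sq_sqrt hQ' hQQ',
    trace_eq_sum_norm_sq_sqrt hS hSS, trace_eq_sum_norm_sq_sqrt hS' hSS', abs_sub_le_iff]
  have h1 := sqrt_bures_le_add (EuclideanSpace.basisFun (Fin m) ℝ) f f' Q.toEuclideanLin
    S.toEuclideanLin Q'.toEuclideanLin S'.toEuclideanLin hQ.toEuclideanLin_isSymmetric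
    hQ'.toEuclideanLin_isSymmetric hf
  have h2 := sqrt_bures_le_add (EuclideanSpace.basisFun (Fin m) ℝ) f' f Q'.toEuclideanLin
    S'.toEuclideanLin Q.toEuclideanLin S.toEuclideanLin hQ'.toEuclideanLin_isSymmetric
    hQ.toEuclideanLin_isSymmetric hf'
  have h3 := sqrt_sum_norm_sq_sqrt_sub_le hQ hQ' hQQ hQQ'
  have h4 := sqrt_sum_norm_sq_sqrt_sub_le hS hS' hSS hSS'
  simp only [LinearMap.sub_apply] at h1 h2 h3 h4
  simp only [norm_sub_rev (Q'.toEuclideanLin _)] at h1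
  simp only [norm_sub_rev (S'.toEuclideanLin _)] at h2
  constructor <;> linarith

end Matrices
section Features

variable {H D : Type*} [NormedAddCommGroup H] [InnerProductSpace ℝ H]
  [NormedAddCommGroup D] [InnerProductSpace ℝ D]

/-- A feature map of a continuous kernel is continuous. -/
theorem continuous_of_inner_eq {T : Type*} [TopologicalSpace T] {K : T → T → ℝ}
    (hK : Continuous fun p : T × T => K p.1 p.2) {Φ : T → H} (hΦ : ∀ s t, ⟪Φ s, Φ t⟫ = K s t) :
    Continuous Φ := by
  rw [continuous_iff_continuousAt]
  intro t
  rw [ContinuousAt, tendsto_iff_norm_sub_tendsto_zero]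
  have h (s) : ‖Φ s - Φ t‖ = √(K s s - 2 * K s t + K t t) := by
    rw [← Real.sqrt_sq (norm_nonneg (Φ s - Φ t)), norm_sub_sq_real, hΦ,
      ← real_inner_self_eq_norm_sq, ← real_inner_self_eq_norm_sq, hΦ, hΦ]
  simp only [h]
  have hc : Continuous fun s => √(K s s - 2 * K s t + K t t) := by
    have h1 : Continuous fun s => K s s := hK.comp (continuous_id.prodMk continuous_id)
    have h2 : Continuous fun s => K s t := hK.comp (continuous_id.prodMk continuous_const)
    fun_prop
  have h0 := hc.tendsto t
  rwa [show K t t - 2 * K t t + K t t = 0 by ring, Real.sqrt_zero] at h0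

/-- A Hilbert basis of a separable Hilbert space is countable. -/
theorem HilbertBasis.countable_of_separableSpace {ι : Type*} [TopologicalSpace.SeparableSpace H]
    (b : HilbertBasis ι ℝ H) : Countable ι := by
  refine Pairwise.countable_of_isOpen_disjoint (s := fun i => Metric.ball (b i) (1 / 2))
    (fun i j hij => Metric.ball_disjoint_ball ?_) (fun i => Metric.isOpen_ball)
    (fun i => ⟨b i, Metric.mem_ball_self (by norm_num)⟩)
  have h : ‖b i - b j‖ ^ 2 = 2 := by
    rw [norm_sub_sq_real, b.orthonormal.1, b.orthonormal.1, b.orthonormal.2 hij]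
    norm_num
  rw [dist_eq_norm]
  nlinarith [norm_nonneg (b i - b j)]

/-- Parseval's identity in extended nonnegative reals. -/
theorem HilbertBasis.tsum_ofReal_inner_sq {ι : Type*} (b : HilbertBasis ι ℝ H) (x : H) :
    ∑' i, ENNReal.ofReal (⟪b i, x⟫ ^ 2) = ENNReal.ofReal (‖x‖ ^ 2) := by
  have h := b.hasSum_inner_mul_inner x x
  have h' : (fun i => ⟪x, b i⟫ * ⟪b i, x⟫) = fun i => ⟪b i, x⟫ ^ 2 := by
    ext i
    rw [real_inner_comm, sq]
  rw [real_inner_self_eq_norm_sq, h'] at h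
  rw [← h.tsum_eq, ENNReal.ofReal_tsum_of_nonneg (fun i => sq_nonneg _) h.summable]

/-- The trace of the positive square root of `S B S` with `S ^ 2` and `B` Gram matrices, in terms
of the feature vectors. -/
theorem trace_sqrt_conj_eq_sum_norm {m : ℕ} {ι : Type*} [Fintype ι] {c : ℝ} (hc : 0 ≤ c)
    (u : Fin m → H) (v : Fin m → D) {S A B M : Matrix (Fin m) (Fin m) ℝ}
    (hA : ∀ a b, A a b = c * ⟪u a, u b⟫) (hB : ∀ a b, B a b = c * ⟪v a, v b⟫)
    (hS : S.PosSemidef) (hSS : S * S = A) (hM : M.PosSemidef) (hMM : M * M = S * B * S)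
    (X : D →ₗ[ℝ] H) (hX : ∀ h, X h = c • ∑ a, ⟪v a, h⟫ • u a) (f : OrthonormalBasis ι ℝ D)
    (hf : Pairwise fun i j => ⟪X (f i), X (f j)⟫ = 0) :
    M.trace = ∑ i, ‖X (f i)‖ := by
  let β : ι → EuclideanSpace ℝ (Fin m) := fun i => WithLp.toLp 2 fun a => √c * ⟪v a, f i⟫
  have hcc : √c * √c = c := Real.mul_self_sqrt hc
  have hβ (i j) : ⟪β i, A.toEuclideanLin (β j)⟫ = ⟪X (f i), X (f j)⟫ := by
    rw [hX, hX, real_inner_smul_left, real_inner_smul_right, sum_inner, PiLp.inner_apply,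
      Finset.mul_sum, Finset.mul_sum]
    refine Finset.sum_congr rfl fun a _ => ?_
    simp only [β, Matrix.toLpLin_apply, Matrix.mulVec, dotProduct, hA, inner_sum,
      real_inner_smul_left, real_inner_smul_right, RCLike.inner_apply, conj_trivial,
      Finset.mul_sum, Finset.sum_mul]
    refine Finset.sum_congr rfl fun b _ => ?_
    linear_combination (c * ⟪u a, u b⟫ * ⟪v a, f i⟫ * ⟪v b, f j⟫) * hcc
  have h := hasSum_inner_sqrt_conj (EuclideanSpace.basisFun (Fin m) ℝ).toHilbertBasis
    S.toEuclideanLin A.toEuclideanLin B.toEuclideanLin M.toEuclideanLin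
    hS.toEuclideanLin_isSymmetric (fun x => by rw [← toEuclideanLin_mul_apply, hSS])
    hM.toEuclideanLin_isSymmetric hM.inner_toEuclideanLin_nonneg
    (fun x => by simp only [← toEuclideanLin_mul_apply, hMM, mul_assoc]) β (fun x => ?_)
    (fun i j hij => (hβ i j).trans (hf hij))
  · simp only [hβ, real_inner_self_eq_norm_sq, Real.sqrt_sq (norm_nonneg _),
      OrthonormalBasis.coe_toHilbertBasis] at h
    rw [← sum_inner_basisFun_toEuclideanLin]
    exact (hasSum_fintype _).unique h
  · ext a
    simp only [β, Matrix.toLpLin_apply, Matrix.mulVec, dotProduct, hB, WithLp.ofLp_sum,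
      WithLp.ofLp_smul, Finset.sum_apply, Pi.smul_apply, smul_eq_mul, PiLp.inner_apply,
      RCLike.inner_apply, conj_trivial, Finset.sum_mul]
    rw [Finset.sum_comm]
    refine Finset.sum_congr rfl fun b _ => ?_
    rw [← f.sum_inner_mul_inner, Finset.mul_sum, Finset.sum_mul]
    refine Finset.sum_congr rfl fun i _ => ?_
    rw [real_inner_comm (v b) (f i)]
    linear_combination (-⟪v a, f i⟫ * ⟪v b, f i⟫ * x.ofLp b) * hcc

end Features

section Population

variable {T : Type*} [MeasurableSpace T] {ν : Measure T}
  {H : Type*} [NormedAddCommGroup H] [InnerProductSpace ℝ H]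
  {Φ : T → H} {κ : ℝ}

theorem integrable_smul_feature (hΦ : StronglyMeasurable Φ) (hκ : ∀ t, ‖Φ t‖ ≤ κ)
    {f : T → ℝ} (hf : Integrable f ν) : Integrable (fun t => f t • Φ t) ν :=
  hf.smul_of_top_left (memLp_top_of_bound hΦ.aestronglyMeasurable κ (ae_of_all _ hκ))

variable [IsProbabilityMeasure ν]

theorem memLp_inner_feature (hΦ : StronglyMeasurable Φ) (hκ : ∀ t, ‖Φ t‖ ≤ κ) (h : H) :
    MemLp (fun t => ⟪Φ t, h⟫) 2 ν := by
  refine MemLp.of_bound (hΦ.inner stronglyMeasurable_const).aestronglyMeasurable (κ * ‖h‖)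
    (ae_of_all _ fun t => (norm_inner_le_norm _ _).trans ?_)
  gcongr
  exact hκ t

theorem Lp_two_integrable (f : Lp ℝ 2 ν) : Integrable f ν :=
  (Lp.memLp f).integrable (by norm_num)

theorem inner_integral_smul_feature [CompleteSpace H] (hΦ : StronglyMeasurable Φ)
    (hκ : ∀ t, ‖Φ t‖ ≤ κ) (f : Lp ℝ 2 ν) (h : H) :
    ⟪h, ∫ t, f t • Φ t ∂ν⟫ = ⟪(memLp_inner_feature (ν := ν) hΦ hκ h).toLp _, f⟫ := by
  rw [← integral_inner (integrable_smul_feature hΦ hκ (Lp_two_integrable f)), L2.inner_def]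
  refine integral_congr_ae ?_
  filter_upwards [(memLp_inner_feature (ν := ν) hΦ hκ h).coeFn_toLp] with t ht
  rw [ht, real_inner_smul_right, real_inner_comm h (Φ t)]
  simp

/-- The covariance operator is the Gram operator of the integral of the feature map. -/
theorem inner_covariance_eq [CompleteSpace H] (hΦ : StronglyMeasurable Φ) (hκ : ∀ t, ‖Φ t‖ ≤ κ)
    {K : T → T → ℝ} (hK : ∀ s t, ⟪Φ s, Φ t⟫ = K s t) {C : Lp ℝ 2 ν →L[ℝ] Lp ℝ 2 ν}
    (hC : ∀ f : Lp ℝ 2 ν, ⇑(C f) =ᵐ[ν] fun x => ∫ t, K x t * f t ∂ν) (f g : Lp ℝ 2 ν) :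
    ⟪f, C g⟫ = ⟪∫ t, f t • Φ t ∂ν, ∫ t, g t • Φ t ∂ν⟫ := by
  rw [real_inner_comm (∫ t, g t • Φ t ∂ν),
    ← integral_inner (integrable_smul_feature hΦ hκ (Lp_two_integrable f)), L2.inner_def]
  refine integral_congr_ae ?_
  filter_upwards [hC g] with x hx
  rw [hx, real_inner_smul_right, real_inner_comm (Φ x),
    ← integral_inner (integrable_smul_feature hΦ hκ (Lp_two_integrable g))]
  simp only [real_inner_smul_right, hK, RCLike.inner_apply, conj_trivial]
  rw [mul_comm]
  congr 2
  ext t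
  ring

theorem tsum_inner_covariance_of_separable [CompleteSpace H] [TopologicalSpace.SeparableSpace H]
    (hΦ : StronglyMeasurable Φ) (hκ : ∀ t, ‖Φ t‖ ≤ κ)
    {K : T → T → ℝ} (hK : ∀ s t, ⟪Φ s, Φ t⟫ = K s t) {C : Lp ℝ 2 ν →L[ℝ] Lp ℝ 2 ν}
    (hC : ∀ f : Lp ℝ 2 ν, ⇑(C f) =ᵐ[ν] fun x => ∫ t, K x t * f t ∂ν)
    {ι : Type*} (e : HilbertBasis ι ℝ (Lp ℝ 2 ν)) :
    ∑' k, ⟪e k, C (e k)⟫ = ∫ t, K t t ∂ν := by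
  obtain ⟨s, b, -⟩ := exists_hilbertBasis ℝ H
  have : Countable s := b.countable_of_separableSpace
  have hR (l) (t) : ⟪b l, Φ t⟫ ^ 2 = ⟪Φ t, b l⟫ ^ 2 := by rw [real_inner_comm]
  have hterm (k) : ENNReal.ofReal ⟪e k, C (e k)⟫ =
      ∑' l, ENNReal.ofReal (⟪e k, (memLp_inner_feature (ν := ν) hΦ hκ (b l)).toLp _⟫ ^ 2) := by
    rw [inner_covariance_eq hΦ hκ hK hC, real_inner_self_eq_norm_sq, ← b.tsum_ofReal_inner_sq]
    simp only [inner_integral_smul_feature hΦ hκ, real_inner_comm]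
  have hpos (k) : 0 ≤ ⟪e k, C (e k)⟫ := by
    rw [inner_covariance_eq hΦ hκ hK hC]
    exact real_inner_self_nonneg
  have hnorm (l) : ENNReal.ofReal (‖(memLp_inner_feature (ν := ν) hΦ hκ (b l)).toLp _‖ ^ 2) =
      ∫⁻ t, ENNReal.ofReal (⟪b l, Φ t⟫ ^ 2) ∂ν := by
    have hint := (memLp_inner_feature (ν := ν) hΦ hκ (b l)).integrable_sq
    simp only [hR]
    rw [← ofReal_integral_eq_lintegral_ofReal hint (ae_of_all _ fun t => sq_nonneg _),
      ← real_inner_self_eq_norm_sq, L2.inner_def]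
    congr 1
    refine integral_congr_ae ?_
    filter_upwards [(memLp_inner_feature (ν := ν) hΦ hκ (b l)).coeFn_toLp] with t ht
    rw [ht, RCLike.inner_apply, conj_trivial, sq]
  have hKt (t) : K t t = ‖Φ t‖ ^ 2 := by rw [← hK, real_inner_self_eq_norm_sq]
  have hint : Integrable (fun t => K t t) ν := by
    simp only [hKt]
    refine Integrable.of_bound (hΦ.norm.pow 2).aestronglyMeasurable (κ ^ 2)
      (ae_of_all _ fun t => ?_)
    rw [Real.norm_of_nonneg (sq_nonneg _)]
    exact pow_le_pow_left₀ (norm_nonneg _) (hκ t) 2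
  have key : ∑' k, ENNReal.ofReal ⟪e k, C (e k)⟫ = ENNReal.ofReal (∫ t, K t t ∂ν) := by
    simp only [hterm]
    rw [ENNReal.tsum_comm]
    simp only [e.tsum_ofReal_inner_sq, hnorm]
    rw [← lintegral_tsum, ofReal_integral_eq_lintegral_ofReal hint
      (ae_of_all _ fun t => by simp only [hKt]; exact sq_nonneg _)]
    · simp only [b.tsum_ofReal_inner_sq, hKt]
    · intro l
      exact ((stronglyMeasurable_const.inner hΦ).measurable.pow_const 2).ennreal_ofReal.aemeasurable
  have h := congrArg ENNReal.toReal key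
  rw [ENNReal.tsum_toReal_eq fun k => ENNReal.ofReal_ne_top, ENNReal.toReal_ofReal
    (integral_nonneg fun t => by simp only [hKt]; exact sq_nonneg _)] at h
  simpa only [ENNReal.toReal_ofReal (hpos _)] using h

/-- The trace of the covariance operator along a Hilbert basis is the integral of the kernel on
the diagonal. -/
theorem tsum_inner_covariance [TopologicalSpace T] [SecondCountableTopology T]
    [OpensMeasurableSpace T] [CompleteSpace H]
    (hΦ : Continuous Φ) (hκ : ∀ t, ‖Φ t‖ ≤ κ)
    {K : T → T → ℝ} (hK : ∀ s t, ⟪Φ s, Φ t⟫ = K s t) {C : Lp ℝ 2 ν →L[ℝ] Lp ℝ 2 ν}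
    (hC : ∀ f : Lp ℝ 2 ν, ⇑(C f) =ᵐ[ν] fun x => ∫ t, K x t * f t ∂ν)
    {ι : Type*} (e : HilbertBasis ι ℝ (Lp ℝ 2 ν)) :
    ∑' k, ⟪e k, C (e k)⟫ = ∫ t, K t t ∂ν := by
  let V := (Submodule.span ℝ (Set.range Φ)).topologicalClosure
  have hV : TopologicalSpace.IsSeparable (V : Set H) :=
    (TopologicalSpace.isSeparable_range hΦ).span.closure
  have : TopologicalSpace.SeparableSpace V := hV.separableSpace
  let Ψ : T → V := fun t =>
    ⟨Φ t, Submodule.le_topologicalClosure _ (Submodule.subset_span ⟨t, rfl⟩)⟩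
  have hΨ : Continuous Ψ := hΦ.subtype_mk _
  exact tsum_inner_covariance_of_separable hΨ.stronglyMeasurable hκ (fun s t => hK s t) hC e

/-- The trace of the positive square root of `C₁^{1/2} C₂ C₁^{1/2}` in terms of feature maps. -/
theorem tsum_inner_sqrt_covariance [CompleteSpace H] {D : Type*} [NormedAddCommGroup D]
    [InnerProductSpace ℝ D] [CompleteSpace D] {Ψ : T → D} {κ' : ℝ}
    (hΦ : StronglyMeasurable Φ) (hκ : ∀ t, ‖Φ t‖ ≤ κ)
    (hΨ : StronglyMeasurable Ψ) (hκ' : ∀ t, ‖Ψ t‖ ≤ κ')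
    {K₁ K₂ : T → T → ℝ} (hK₁ : ∀ s t, ⟪Φ s, Φ t⟫ = K₁ s t) (hK₂ : ∀ s t, ⟪Ψ s, Ψ t⟫ = K₂ s t)
    {C₁ C₂ Q M : Lp ℝ 2 ν →L[ℝ] Lp ℝ 2 ν}
    (hC₁ : ∀ f : Lp ℝ 2 ν, ⇑(C₁ f) =ᵐ[ν] fun x => ∫ t, K₁ x t * f t ∂ν)
    (hC₂ : ∀ f : Lp ℝ 2 ν, ⇑(C₂ f) =ᵐ[ν] fun x => ∫ t, K₂ x t * f t ∂ν)
    (hQ : Q.IsPositive) (hQQ : Q ∘L Q = C₁) (hM : M.IsPositive) (hMM : M ∘L M = Q ∘L C₂ ∘L Q)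
    {ι κ : Type*} [Fintype κ] (e : HilbertBasis ι ℝ (Lp ℝ 2 ν))
    (X : D →ₗ[ℝ] H) (hX : ∀ h, X h = ∫ t, ⟪Ψ t, h⟫ • Φ t ∂ν) (f : OrthonormalBasis κ ℝ D)
    (hf : Pairwise fun i j => ⟪X (f i), X (f j)⟫ = 0) :
    ∑' k, ⟪e k, M (e k)⟫ = ∑ i, ‖X (f i)‖ := by
  let β : κ → Lp ℝ 2 ν := fun i => (memLp_inner_feature (ν := ν) hΨ hκ' (f i)).toLp _
  have hX' (i) : ∫ t, β i t • Φ t ∂ν = X (f i) := by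
    rw [hX]
    refine integral_congr_ae ?_
    filter_upwards [(memLp_inner_feature (ν := ν) hΨ hκ' (f i)).coeFn_toLp] with t ht
    rw [ht]
  have hβ (i j) : ⟪β i, C₁ (β j)⟫ = ⟪X (f i), X (f j)⟫ := by
    rw [inner_covariance_eq hΦ hκ hK₁ hC₁, hX', hX']
  have h := hasSum_inner_sqrt_conj e Q.toLinearMap C₁.toLinearMap C₂.toLinearMap M.toLinearMap
    hQ.isSymmetric (fun x => by rw [← hQQ]; rfl) hM.isSymmetric
    (fun x => hM.inner_nonneg_left x) (fun x => congrArg (fun L => L x) hMM) β (fun x => ?_)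
    (fun i j hij => (hβ i j).trans (hf hij))
  · have h' := h.tsum_eq
    simp only [ContinuousLinearMap.coe_coe, hβ, real_inner_self_eq_norm_sq,
      Real.sqrt_sq (norm_nonneg _)] at h'
    exact h'
  · refine ext_inner_left ℝ fun y => ?_
    rw [ContinuousLinearMap.coe_coe, inner_covariance_eq hΨ hκ' hK₂ hC₂, inner_sum,
      ← f.sum_inner_mul_inner]
    refine Finset.sum_congr rfl fun i _ => ?_
    rw [real_inner_comm (f i), inner_integral_smul_feature hΨ hκ',
      inner_integral_smul_feature hΨ hκ', real_inner_smul_right, mul_comm, real_inner_comm y]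

end Population
section Concentration

theorem Real.cosh_le_of_sq_le {x p q a b : ℝ} (ha : 0 ≤ a) (hb : 0 ≤ b) (hab : a + b = 1)
    (h : x ^ 2 ≤ a * p ^ 2 + b * q ^ 2) : Real.cosh x ≤ a * Real.cosh p + b * Real.cosh q := by
  refine hasSum_le (fun n => ?_) (Real.hasSum_cosh x)
    (((Real.hasSum_cosh p).mul_left a).add ((Real.hasSum_cosh q).mul_left b))
  simp only [pow_mul]
  have h1 : (x ^ 2) ^ n ≤ a * (p ^ 2) ^ n + b * (q ^ 2) ^ n :=
    (pow_le_pow_left₀ (sq_nonneg x) h n).trans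
      ((convexOn_pow n).2 (sq_nonneg p) (sq_nonneg q) ha hb hab)
  rw [← mul_div_assoc, ← mul_div_assoc, ← add_div]
  gcongr

variable {H : Type*} [NormedAddCommGroup H] [InnerProductSpace ℝ H]

theorem cosh_norm_add_le {c : ℝ} (s : H) {y : H} (hy : ‖y‖ ≤ c) :
    Real.cosh ‖s + y‖ ≤ Real.cosh ‖s‖ * Real.cosh c +
      (Real.sinh ‖s‖ * Real.sinh c / (‖s‖ * c)) * ⟪s, y⟫ := by
  have hc : 0 ≤ c := (norm_nonneg y).trans hy
  rcases eq_or_lt_of_le (norm_nonneg s) with hs | hs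
  · rw [norm_eq_zero.1 hs.symm]
    have h : Real.cosh ‖y‖ ≤ Real.cosh c :=
      Real.cosh_le_cosh.2 (by rwa [abs_of_nonneg hc, abs_of_nonneg (norm_nonneg y)])
    simpa using h
  rcases eq_or_lt_of_le hc with hc0 | hc0
  · have : y = 0 := norm_le_zero_iff.1 (hc0 ▸ hy)
    simp [this, ← hc0]
  have ha := abs_le.1 ((abs_real_inner_le_norm s y).trans
    (mul_le_mul_of_nonneg_left hy (norm_nonneg s)))
  have hsc : 0 < ‖s‖ * c := mul_pos hs hc0
  set r := ⟪s, y⟫ / (‖s‖ * c) with hr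
  have hr1 : r ≤ 1 := (div_le_one hsc).2 ha.2
  have hr2 : -1 ≤ r := (le_div_iff₀ hsc).2 (by linarith [ha.1])
  have hin : ⟪s, y⟫ = r * (‖s‖ * c) := by rw [hr]; field_simp
  have h := Real.cosh_le_of_sq_le (x := ‖s + y‖) (p := ‖s‖ + c) (q := ‖s‖ - c)
    (a := (1 + r) / 2) (b := (1 - r) / 2) (by linarith) (by linarith) (by ring) (by
      rw [norm_add_sq_real, hin]
      nlinarith [pow_le_pow_left₀ (norm_nonneg y) hy 2])
  refine h.trans (le_of_eq ?_)
  rw [Real.cosh_add, Real.cosh_sub, hin]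
  field_simp
  ring

variable {T : Type*} [MeasurableSpace T] {ν : Measure T} [IsProbabilityMeasure ν]
  {Y : T → H} {c : ℝ}

theorem lintegral_cosh_norm_add_le [CompleteSpace H] (hY : StronglyMeasurable Y)
    (hc : ∀ t, ‖Y t‖ ≤ c) (h0 : ∫ t, Y t ∂ν = 0) (s : H) :
    ∫⁻ t, ENNReal.ofReal (Real.cosh ‖Y t + s‖) ∂ν ≤
      ENNReal.ofReal (Real.cosh c) * ENNReal.ofReal (Real.cosh ‖s‖) := by
  have hint : Integrable Y ν := Integrable.of_bound hY.aestronglyMeasurable c (ae_of_all _ hc)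
  set k := Real.sinh ‖s‖ * Real.sinh c / (‖s‖ * c)
  have hint' : Integrable
      (fun t => Real.cosh ‖s‖ * Real.cosh c + k * ⟪s, Y t⟫) ν :=
    (integrable_const _).add ((hint.const_inner s).const_mul k)
  have hle (t) := cosh_norm_add_le s (hc t)
  calc ∫⁻ t, ENNReal.ofReal (Real.cosh ‖Y t + s‖) ∂ν
      ≤ ∫⁻ t, ENNReal.ofReal (Real.cosh ‖s‖ * Real.cosh c + k * ⟪s, Y t⟫) ∂ν := by
        refine lintegral_mono fun t => ENNReal.ofReal_le_ofReal ?_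
        rw [add_comm (Y t)]
        exact hle t
    _ = ENNReal.ofReal (∫ t, (Real.cosh ‖s‖ * Real.cosh c + k * ⟪s, Y t⟫) ∂ν) :=
        (ofReal_integral_eq_lintegral_ofReal hint'
          (ae_of_all _ fun t => (Real.cosh_pos _).le.trans (hle t))).symm
    _ = ENNReal.ofReal (Real.cosh c) * ENNReal.ofReal (Real.cosh ‖s‖) := by
        rw [integral_add (integrable_const _) ((hint.const_inner s).const_mul k),
          integral_const_mul k, integral_inner hint, h0, ← ENNReal.ofReal_mul (Real.cosh_pos _).le]
        simp [mul_comm]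

theorem lintegral_cosh_norm_sum_le [CompleteSpace H] (hY : StronglyMeasurable Y)
    (hc : ∀ t, ‖Y t‖ ≤ c) (h0 : ∫ t, Y t ∂ν = 0) (m : ℕ) :
    ∫⁻ x, ENNReal.ofReal (Real.cosh ‖∑ i, Y (x i)‖) ∂(Measure.pi fun _ : Fin m => ν) ≤
      ENNReal.ofReal (Real.cosh c) ^ m := by
  induction m with
  | zero => simp
  | succ m ih =>
    have hS : StronglyMeasurable fun x : Fin m → T => ∑ i, Y (x i) :=
      Finset.stronglyMeasurable_fun_sum _ fun i _ => hY.comp_measurable (measurable_pi_apply i)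
    have hmeas : Measurable fun z : T × (Fin m → T) =>
        ENNReal.ofReal (Real.cosh ‖Y z.1 + ∑ i, Y (z.2 i)‖) :=
      (Real.measurable_cosh.comp ((hY.comp_measurable measurable_fst).add
        (hS.comp_measurable measurable_snd)).norm.measurable).ennreal_ofReal
    have hmp := measurePreserving_piFinSuccAbove (fun _ : Fin (m + 1) => ν) 0
    have heq : ∫⁻ x, ENNReal.ofReal (Real.cosh ‖∑ i, Y (x i)‖)
        ∂(Measure.pi fun _ : Fin (m + 1) => ν) =
        ∫⁻ z, ENNReal.ofReal (Real.cosh ‖Y z.1 + ∑ i, Y (z.2 i)‖)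
          ∂(ν.prod (Measure.pi fun _ : Fin m => ν)) := by
      rw [← hmp.lintegral_comp hmeas]
      refine lintegral_congr fun x => ?_
      rw [Fin.sum_univ_succ]
      rfl
    rw [heq, lintegral_prod_symm _ hmeas.aemeasurable, pow_succ']
    calc _ ≤ ∫⁻ x, ENNReal.ofReal (Real.cosh c) * ENNReal.ofReal (Real.cosh ‖∑ i, Y (x i)‖)
          ∂(Measure.pi fun _ : Fin m => ν) :=
          lintegral_mono fun x => lintegral_cosh_norm_add_le hY hc h0 _
      _ ≤ _ := by
          rw [lintegral_const_mul' _ _ ENNReal.ofReal_ne_top]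
          gcongr

/-- Hoeffding's inequality in Hilbert spaces. -/
theorem measure_norm_sum_ge_le [CompleteSpace H] (hY : StronglyMeasurable Y)
    (hc0 : 0 < c) (hc : ∀ t, ‖Y t‖ ≤ c) (h0 : ∫ t, Y t ∂ν = 0) (m : ℕ) {u : ℝ} (hu : 0 ≤ u) :
    (Measure.pi fun _ : Fin m => ν) {x | m * (c * u) ≤ ‖∑ i, Y (x i)‖} ≤
      ENNReal.ofReal (2 * Real.exp (-(m * u ^ 2 / 2))) := by
  set l := u / c with hl
  have hl0 : 0 ≤ l := by positivity
  have hS : StronglyMeasurable fun x : Fin m → T => ∑ i, l • Y (x i) :=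
    Finset.stronglyMeasurable_fun_sum _ fun i _ =>
      (hY.comp_measurable (measurable_pi_apply i)).const_smul l
  have hcosh := lintegral_cosh_norm_sum_le (ν := ν) (Y := fun t => l • Y t) (c := u)
    (hY.const_smul l) (fun t => by
      rw [norm_smul, Real.norm_of_nonneg hl0, hl, div_mul_eq_mul_div, div_le_iff₀ hc0]
      gcongr
      exact hc t) (by rw [integral_smul, h0, smul_zero]) m
  have hmk := mul_meas_ge_le_lintegral₀ (μ := Measure.pi fun _ : Fin m => ν)
    (Real.measurable_cosh.comp hS.norm.measurable).ennreal_ofReal.aemeasurable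
    (ENNReal.ofReal (Real.cosh (m * u ^ 2)))
  have hsub : {x : Fin m → T | m * (c * u) ≤ ‖∑ i, Y (x i)‖} ⊆
      {x | ENNReal.ofReal (Real.cosh (m * u ^ 2)) ≤
        ENNReal.ofReal ((Real.cosh ∘ fun x : Fin m → T => ‖∑ i, l • Y (x i)‖) x)} := by
    intro x hx
    refine ENNReal.ofReal_le_ofReal (Real.cosh_le_cosh.2 ?_)
    rw [abs_of_nonneg (by positivity), abs_of_nonneg (norm_nonneg _), ← Finset.smul_sum,
      norm_smul, Real.norm_of_nonneg hl0]
    calc (m : ℝ) * u ^ 2 = l * (m * (c * u)) := by rw [hl]; field_simp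
      _ ≤ _ := mul_le_mul_of_nonneg_left hx hl0
  have hpow : Real.cosh u ^ m ≤ Real.exp (m * u ^ 2 / 2) := by
    calc Real.cosh u ^ m ≤ Real.exp (u ^ 2 / 2) ^ m :=
          pow_le_pow_left₀ (Real.cosh_pos _).le (Real.cosh_le_exp_half_sq u) m
      _ = _ := by rw [← Real.exp_nat_mul]; ring_nf
  have hcp : 0 < Real.cosh (m * u ^ 2) := Real.cosh_pos _
  have hquot : Real.cosh u ^ m / Real.cosh (m * u ^ 2) ≤ 2 * Real.exp (-(m * u ^ 2 / 2)) := by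
    rw [div_le_iff₀ hcp]
    refine hpow.trans ?_
    have h1 : Real.exp (m * u ^ 2) ≤ 2 * Real.cosh (m * u ^ 2) := by
      rw [Real.cosh_eq]
      linarith [Real.exp_pos (-(m * u ^ 2))]
    calc Real.exp (m * u ^ 2 / 2) = Real.exp (-(m * u ^ 2 / 2)) * Real.exp (m * u ^ 2) := by
          rw [← Real.exp_add]; ring_nf
      _ ≤ Real.exp (-(m * u ^ 2 / 2)) * (2 * Real.cosh (m * u ^ 2)) := by gcongr
      _ = _ := by ring
  refine (measure_mono hsub).trans (le_trans ?_ (ENNReal.ofReal_le_ofReal hquot))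
  rw [ENNReal.ofReal_div_of_pos hcp, ENNReal.le_div_iff_mul_le
    (Or.inl (ENNReal.ofReal_pos.2 hcp).ne') (Or.inl ENNReal.ofReal_ne_top), mul_comm,
    ENNReal.ofReal_pow (Real.cosh_pos _).le]
  exact hmk.trans hcosh

/-- Deviation of an empirical mean in a Hilbert space from its expectation. -/
theorem measure_norm_mean_sub_ge_le [CompleteSpace H] {Z : T → H} (hZ : StronglyMeasurable Z)
    (hZi : Integrable Z ν) (hc0 : 0 < c) (hc : ∀ t, ‖Z t - ∫ s, Z s ∂ν‖ ≤ c) {m : ℕ} (hm : 0 < m)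
    {u : ℝ} (hu : 0 ≤ u) :
    (Measure.pi fun _ : Fin m => ν)
      {x | c * u ≤ ‖(m : ℝ)⁻¹ • ∑ i, Z (x i) - ∫ s, Z s ∂ν‖} ≤
      ENNReal.ofReal (2 * Real.exp (-(m * u ^ 2 / 2))) := by
  have h0 : ∫ t, (Z t - ∫ s, Z s ∂ν) ∂ν = 0 := by
    rw [integral_sub hZi (integrable_const _)]
    simp
  refine (measure_mono fun x hx => ?_).trans
    (measure_norm_sum_ge_le (hZ.sub stronglyMeasurable_const) hc0 hc h0 m hu)
  have hm' : (0 : ℝ) < m := by exact_mod_cast hm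
  have h1 : ∑ i, (Z (x i) - ∫ s, Z s ∂ν) =
      (m : ℝ) • ((m : ℝ)⁻¹ • ∑ i, Z (x i) - ∫ s, Z s ∂ν) := by
    rw [smul_sub, smul_smul, mul_inv_cancel₀ hm'.ne', one_smul, Finset.sum_sub_distrib]
    simp [Nat.cast_smul_eq_nsmul]
  change (m : ℝ) * (c * u) ≤ ‖∑ i, (Z (x i) - ∫ s, Z s ∂ν)‖
  rw [h1, norm_smul, Real.norm_of_nonneg hm'.le]
  exact mul_le_mul_of_nonneg_left hx hm'.le

end Concentration
section Sampling

theorem integral_pow_four_gaussianReal_le {v : NNReal} {κ : ℝ} (hκ : 0 < κ) (hv : v ≤ κ ^ 2) :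
    ∫ x, x ^ 4 ∂(gaussianReal 0 v) ≤ 48 * κ ^ 4 := by
  have hexp (t : ℝ) : ∫ x, Real.exp (t * x) ∂(gaussianReal 0 v) = Real.exp (v * t ^ 2 / 2) := by
    have h := congrFun (mgf_id_gaussianReal (μ := 0) (v := v)) t
    simpa [mgf] using h
  have hi (t : ℝ) := integrable_exp_mul_gaussianReal (μ := 0) (v := v) t
  have hpt (x : ℝ) : x ^ 4 ≤ 12 * κ ^ 4 * (Real.exp (κ⁻¹ * x) + Real.exp (-κ⁻¹ * x)) := by
    have h := (Real.hasSum_cosh (κ⁻¹ * x)).summable.le_tsum 2 fun n _ => by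
      rw [pow_mul]
      positivity
    rw [(Real.hasSum_cosh (κ⁻¹ * x)).tsum_eq, Real.cosh_eq] at h
    norm_num [Nat.factorial] at h
    calc x ^ 4 = κ ^ 4 * 24 * ((κ⁻¹ * x) ^ 4 / 24) := by field_simp
      _ ≤ κ ^ 4 * 24 * ((Real.exp (κ⁻¹ * x) + Real.exp (-(κ⁻¹ * x))) / 2) := by gcongr
      _ = _ := by rw [neg_mul]; ring
  have hquot : v * κ⁻¹ ^ 2 / 2 ≤ 1 / 2 := by
    rw [inv_pow, ← div_eq_mul_inv]
    gcongr
    exact (div_le_one (by positivity)).2 hv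
  have hsqrt : Real.exp (1 / 2) ≤ 2 := by
    have h := Real.exp_one_lt_three
    rw [show (1 : ℝ) = 1 / 2 + 1 / 2 by norm_num, Real.exp_add] at h
    nlinarith [Real.exp_pos (1 / 2)]
  calc ∫ x, x ^ 4 ∂(gaussianReal 0 v)
      ≤ ∫ x, 12 * κ ^ 4 * (Real.exp (κ⁻¹ * x) + Real.exp (-κ⁻¹ * x)) ∂(gaussianReal 0 v) :=
        integral_mono_of_nonneg (ae_of_all _ fun x => by positivity)
          (((hi _).add (hi _)).const_mul _) (ae_of_all _ hpt)
    _ = 12 * κ ^ 4 * (2 * Real.exp (v * κ⁻¹ ^ 2 / 2)) := by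
        rw [integral_const_mul, integral_add (hi _) (hi _), hexp, hexp, neg_sq]
        ring
    _ ≤ 12 * κ ^ 4 * (2 * 2) := by
        gcongr
        exact (Real.exp_le_exp.2 hquot).trans hsqrt
    _ = 48 * κ ^ 4 := by ring

variable {T Ω : Type*} [MeasurableSpace Ω] {P : Measure Ω}
  {ξ : Ω → T → ℝ} {K : T → T → ℝ}

theorem map_eval_eq_gaussianReal
    (hG : ∀ (n : ℕ) (x : Fin n → T) (a : Fin n → ℝ),
      Measure.map (fun ω => ∑ i, a i * ξ ω (x i)) P =
        gaussianReal 0 (∑ i, ∑ j, a i * a j * K (x i) (x j)).toNNReal) (t : T) :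
    Measure.map (fun ω => ξ ω t) P = gaussianReal 0 (K t t).toNNReal := by
  simpa using hG 1 (fun _ => t) fun _ => 1

theorem integral_sq_of_map_eq_gaussianReal {Z : Ω → ℝ} (hZ : Measurable Z) {v : ℝ} (hv : 0 ≤ v)
    (h : Measure.map Z P = gaussianReal 0 v.toNNReal) : ∫ ω, Z ω ^ 2 ∂P = v := by
  have h1 : ∫ z, z ^ 2 ∂(Measure.map Z P) = ∫ ω, Z ω ^ 2 ∂P :=
    integral_map hZ.aemeasurable (by fun_prop)
  have h2 := variance_id_gaussianReal (μ := 0) (v := v.toNNReal)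
  rw [variance_of_integral_eq_zero aemeasurable_id (by simp)] at h2
  rw [← h1, h]
  simpa [hv] using h2

theorem memLp_eval (hξ : ∀ t, Measurable fun ω => ξ ω t)
    (hG : ∀ (n : ℕ) (x : Fin n → T) (a : Fin n → ℝ),
      Measure.map (fun ω => ∑ i, a i * ξ ω (x i)) P =
        gaussianReal 0 (∑ i, ∑ j, a i * a j * K (x i) (x j)).toNNReal) (p : NNReal) (t : T) :
    MemLp (fun ω => ξ ω t) p P := by
  have h := memLp_id_gaussianReal (μ := 0) (v := (K t t).toNNReal) p
  rw [← map_eval_eq_gaussianReal hG t] at h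
  exact h.comp_of_map (hξ t).aemeasurable

theorem integral_eval_mul_eval (hK : ∀ s t, K s t = K t s)
    (hKpos : ∀ (n : ℕ) (x : Fin n → T) (c : Fin n → ℝ),
      0 ≤ ∑ a, ∑ b, c a * c b * K (x a) (x b))
    (hξ : ∀ t, Measurable fun ω => ξ ω t)
    (hG : ∀ (n : ℕ) (x : Fin n → T) (a : Fin n → ℝ),
      Measure.map (fun ω => ∑ i, a i * ξ ω (x i)) P =
        gaussianReal 0 (∑ i, ∑ j, a i * a j * K (x i) (x j)).toNNReal) (s t : T) :
    ∫ ω, ξ ω s * ξ ω t ∂P = K s t := by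
  have hsq (n : ℕ) (x : Fin n → T) (a : Fin n → ℝ) :=
    integral_sq_of_map_eq_gaussianReal
      (Finset.measurable_fun_sum _ fun i _ => (hξ (x i)).const_mul (a i)) (hKpos n x a) (hG n x a)
  have hs := hsq 1 (fun _ => s) fun _ => 1
  have ht := hsq 1 (fun _ => t) fun _ => 1
  have hst := hsq 2 ![s, t] fun _ => 1
  simp only [Fin.sum_univ_two, Fin.sum_univ_one, Matrix.cons_val_zero, Matrix.cons_val_one,
    one_mul] at hs ht hst
  have hL (r : T) : MemLp (fun ω => ξ ω r) 2 P := memLp_eval hξ hG 2 r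
  have hexp : ∫ ω, (ξ ω s + ξ ω t) ^ 2 ∂P =
      ∫ ω, ξ ω s ^ 2 ∂P + 2 * ∫ ω, ξ ω s * ξ ω t ∂P + ∫ ω, ξ ω t ^ 2 ∂P := by
    have hi : Integrable (fun ω => 2 * (ξ ω s * ξ ω t)) P :=
      ((hL s).integrable_mul (hL t)).const_mul 2
    have hi' : Integrable (fun ω => ξ ω s ^ 2 + 2 * (ξ ω s * ξ ω t)) P :=
      (hL s).integrable_sq.add hi
    rw [← integral_const_mul, ← integral_add (hL s).integrable_sq hi,
      ← integral_add hi' (hL t).integrable_sq]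
    congr 1
    ext ω
    ring
  rw [hexp, hs, ht, hK t s] at hst
  linarith

theorem exists_feature_of_gaussian
    (hK : ∀ s t, K s t = K t s)
    (hKpos : ∀ (n : ℕ) (x : Fin n → T) (c : Fin n → ℝ),
      0 ≤ ∑ a, ∑ b, c a * c b * K (x a) (x b))
    (hξ : ∀ t, Measurable fun ω => ξ ω t)
    (hG : ∀ (n : ℕ) (x : Fin n → T) (a : Fin n → ℝ),
      Measure.map (fun ω => ∑ i, a i * ξ ω (x i)) P =
        gaussianReal 0 (∑ i, ∑ j, a i * a j * K (x i) (x j)).toNNReal) :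
    ∃ Φ : T → Lp ℝ 2 P, ∀ s t, ⟪Φ s, Φ t⟫ = K s t := by
  have hL (t : T) : MemLp (fun ω => ξ ω t) 2 P := memLp_eval hξ hG 2 t
  refine ⟨fun t => (hL t).toLp _, fun s t => ?_⟩
  rw [← integral_eval_mul_eval hK hKpos hξ hG s t, L2.inner_def]
  refine integral_congr_ae ?_
  filter_upwards [(hL s).coeFn_toLp, (hL t).coeFn_toLp] with ω hs ht
  rw [hs, ht, RCLike.inner_apply, conj_trivial, mul_comm]

theorem integral_sq_eval_mul_eval_le {κ : ℝ} (hκ : 0 < κ) (hKκ : ∀ t, K t t ≤ κ ^ 2)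
    (hξ : ∀ t, Measurable fun ω => ξ ω t)
    (hG : ∀ (n : ℕ) (x : Fin n → T) (a : Fin n → ℝ),
      Measure.map (fun ω => ∑ i, a i * ξ ω (x i)) P =
        gaussianReal 0 (∑ i, ∑ j, a i * a j * K (x i) (x j)).toNNReal) (s t : T) :
    ∫ ω, (ξ ω s * ξ ω t) ^ 2 ∂P ≤ 48 * κ ^ 4 := by
  have h4 (r : T) : ∫ ω, ξ ω r ^ 4 ∂P ≤ 48 * κ ^ 4 := by
    have h1 : ∫ z, z ^ 4 ∂(Measure.map (fun ω => ξ ω r) P) = ∫ ω, ξ ω r ^ 4 ∂P :=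
      integral_map (hξ r).aemeasurable (by fun_prop)
    rw [← h1, map_eval_eq_gaussianReal hG]
    refine integral_pow_four_gaussianReal_le hκ ?_
    rw [Real.coe_toNNReal']
    exact max_le (hKκ r) (sq_nonneg κ)
  have hi (r : T) : Integrable (fun ω => ξ ω r ^ 4) P := by
    have h := (memLp_eval hξ hG 4 r).integrable_norm_pow (p := 4) (by norm_num)
    simpa [(show Even 4 by decide).pow_abs] using h
  calc ∫ ω, (ξ ω s * ξ ω t) ^ 2 ∂P ≤ ∫ ω, (1 / 2) * (ξ ω s ^ 4 + ξ ω t ^ 4) ∂P :=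
        integral_mono_of_nonneg (ae_of_all _ fun ω => sq_nonneg _)
          (((hi s).add (hi t)).const_mul _) (ae_of_all _ fun ω => by
            change (ξ ω s * ξ ω t) ^ 2 ≤ (1 / 2) * (ξ ω s ^ 4 + ξ ω t ^ 4)
            nlinarith [sq_nonneg (ξ ω s ^ 2 - ξ ω t ^ 2)])
    _ = (1 / 2) * (∫ ω, ξ ω s ^ 4 ∂P + ∫ ω, ξ ω t ^ 4 ∂P) := by
        rw [integral_const_mul, integral_add (hi s) (hi t)]
    _ ≤ 48 * κ ^ 4 := by linarith [h4 s, h4 t]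

theorem memLp_eval_mul_eval (hξ : ∀ t, Measurable fun ω => ξ ω t)
    (hG : ∀ (n : ℕ) (x : Fin n → T) (a : Fin n → ℝ),
      Measure.map (fun ω => ∑ i, a i * ξ ω (x i)) P =
        gaussianReal 0 (∑ i, ∑ j, a i * a j * K (x i) (x j)).toNNReal) (s t : T) :
    MemLp (fun ω => ξ ω s * ξ ω t) 2 P := by
  have : ENNReal.HolderTriple 4 4 2 := ⟨by
    rw [← two_mul, show (4 : ENNReal) = 2 * 2 by norm_num,
      ENNReal.mul_inv (by norm_num) (by norm_num), ← mul_assoc,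
      ENNReal.mul_inv_cancel (by norm_num) (by norm_num), one_mul]⟩
  have h (r : T) : MemLp (fun ω => ξ ω r) 4 P := memLp_eval hξ hG 4 r
  exact (h t).mul (h s)

variable [IsProbabilityMeasure P]

/-- Concentration of the sample covariance matrix in Hilbert–Schmidt norm. -/
theorem measure_sum_sq_sampleCovariance_sub_ge_le {κ : ℝ} (hκ : 0 < κ)
    (hKκ : ∀ t, K t t ≤ κ ^ 2) (hK : ∀ s t, K s t = K t s)
    (hKpos : ∀ (n : ℕ) (x : Fin n → T) (c : Fin n → ℝ),
      0 ≤ ∑ a, ∑ b, c a * c b * K (x a) (x b))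
    (hξ : ∀ t, Measurable fun ω => ξ ω t)
    (hG : ∀ (n : ℕ) (x : Fin n → T) (a : Fin n → ℝ),
      Measure.map (fun ω => ∑ i, a i * ξ ω (x i)) P =
        gaussianReal 0 (∑ i, ∑ j, a i * a j * K (x i) (x j)).toNNReal)
    {m N : ℕ} (hN : 0 < N) (x : Fin m → T) {r : ℝ} (hr : 0 < r) :
    (Measure.pi fun _ : Fin N => P) {W | r ≤ ∑ a, ∑ b,
      ((m : ℝ)⁻¹ * ((N : ℝ)⁻¹ * ∑ j, ξ (W j) (x a) * ξ (W j) (x b)) -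
        (m : ℝ)⁻¹ * K (x a) (x b)) ^ 2} ≤ ENNReal.ofReal (48 * κ ^ 4 / (N * r)) := by
  have hN' : (0 : ℝ) < N := by exact_mod_cast hN
  let S (s t : T) : (Fin N → Ω) → ℝ := ∑ j, fun W => ξ (W j) s * ξ (W j) t
  have hL (s t : T) := memLp_eval_mul_eval hξ hG s t
  have hSL (s t : T) : MemLp (S s t) 2 (Measure.pi fun _ : Fin N => P) :=
    memLp_finsetSum' _ fun j _ =>
      (hL s t).comp_measurePreserving (measurePreserving_eval (fun _ : Fin N => P) j)
  have hmean (s t : T) : ∫ W, S s t W ∂(Measure.pi fun _ : Fin N => P) = N * K s t := by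
    simp only [S, Finset.sum_apply]
    rw [integral_finsetSum]
    · have h (j : Fin N) : ∫ W : Fin N → Ω, ξ (W j) s * ξ (W j) t ∂(Measure.pi fun _ => P) =
          K s t := by
        rw [← integral_eval_mul_eval hK hKpos hξ hG s t]
        exact integral_comp_eval (μ := fun _ : Fin N => P) (i := j)
          (f := fun ω => ξ ω s * ξ ω t) ((hξ s).mul (hξ t)).aestronglyMeasurable
      simp [h]
    · exact fun j _ => ((hL s t).comp_measurePreserving
        (measurePreserving_eval (fun _ : Fin N => P) j)).integrable (by norm_num)
  have hvar (s t : T) : ∫ W, (S s t W - N * K s t) ^ 2 ∂(Measure.pi fun _ : Fin N => P) ≤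
      N * (48 * κ ^ 4) := by
    rw [← hmean s t, ← variance_eq_integral (hSL s t).aemeasurable]
    simp only [S]
    rw [variance_sum_pi (μ := fun _ : Fin N => P) (X := fun _ ω => ξ ω s * ξ ω t) fun _ => hL s t]
    have h := (variance_le_expectation_sq (hL s t).aestronglyMeasurable).trans
      (integral_sq_eval_mul_eval_le hκ hKκ hξ hG s t)
    calc _ ≤ ∑ _j : Fin N, 48 * κ ^ 4 := Finset.sum_le_sum fun j _ => h
      _ = _ := by simp
  let F : (Fin N → Ω) → ℝ := fun W => ∑ a, ∑ b,
    ((m : ℝ)⁻¹ * ((N : ℝ)⁻¹ * ∑ j, ξ (W j) (x a) * ξ (W j) (x b)) -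
        (m : ℝ)⁻¹ * K (x a) (x b)) ^ 2
  have hF (W) : F W = ∑ a, ∑ b,
      ((m : ℝ)⁻¹ * (N : ℝ)⁻¹) ^ 2 * (S (x a) (x b) W - N * K (x a) (x b)) ^ 2 := by
    refine Finset.sum_congr rfl fun a _ => Finset.sum_congr rfl fun b _ => ?_
    simp only [S, Finset.sum_apply]
    rw [← mul_pow]
    congr 1
    field_simp
  have hi (s t : T) : Integrable
      (fun W => ((m : ℝ)⁻¹ * (N : ℝ)⁻¹) ^ 2 * (S s t W - N * K s t) ^ 2)
      (Measure.pi fun _ : Fin N => P) :=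
    ((hSL s t).sub (memLp_const _)).integrable_sq.const_mul _
  have hFi : Integrable F (Measure.pi fun _ : Fin N => P) := by
    rw [funext hF]
    exact integrable_finsetSum _ fun a _ => integrable_finsetSum _ fun b _ => hi _ _
  have hFint : ∫ W, F W ∂(Measure.pi fun _ : Fin N => P) ≤ 48 * κ ^ 4 / N := by
    simp only [hF]
    rw [integral_finsetSum _ fun a _ => integrable_finsetSum _ fun b _ => hi _ _]
    calc _ ≤ ∑ _a : Fin m, ∑ _b : Fin m, ((m : ℝ)⁻¹ * (N : ℝ)⁻¹) ^ 2 * (N * (48 * κ ^ 4)) := by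
          refine Finset.sum_le_sum fun a _ => ?_
          rw [integral_finsetSum _ fun b _ => hi _ _]
          refine Finset.sum_le_sum fun b _ => ?_
          rw [integral_const_mul]
          gcongr
          exact hvar _ _
      _ = ((m : ℝ) * (m : ℝ)⁻¹) ^ 2 * (48 * κ ^ 4 / N) := by
          simp only [Finset.sum_const, Finset.card_univ, Fintype.card_fin, nsmul_eq_mul]
          field_simp
      _ ≤ 1 ^ 2 * (48 * κ ^ 4 / N) := by
          gcongr
          exact mul_inv_le_one
      _ = _ := by ring
  have hF0 (W) : 0 ≤ F W := Finset.sum_nonneg fun a _ => Finset.sum_nonneg fun b _ => sq_nonneg _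
  have hmk := mul_meas_ge_le_integral_of_nonneg (ae_of_all _ hF0) hFi r
  have hreal : (Measure.pi fun _ : Fin N => P).real {W | r ≤ F W} ≤ 48 * κ ^ 4 / (N * r) := by
    rw [← div_div, le_div_iff₀ hr, mul_comm]
    exact hmk.trans hFint
  rw [← ofReal_measureReal]
  exact ENNReal.ofReal_le_ofReal hreal

end Sampling
section FeatureProduct

variable {T : Type*}
  {H D : Type*} [NormedAddCommGroup H] [InnerProductSpace ℝ H]
  [NormedAddCommGroup D] [InnerProductSpace ℝ D] {ι : Type*} [Fintype ι]

/-- The tensor product of two feature vectors, in coordinates along an orthonormal basis of the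
second feature space. -/
def featureProduct (e : OrthonormalBasis ι ℝ D) (Φ : T → H) (Ψ : T → D) (t : T) :
    PiLp 2 fun _ : ι => H :=
  WithLp.toLp 2 fun i => ⟪Ψ t, e i⟫ • Φ t

theorem norm_featureProduct (e : OrthonormalBasis ι ℝ D) (Φ : T → H) (Ψ : T → D) (t : T) :
    ‖featureProduct e Φ Ψ t‖ = ‖Φ t‖ * ‖Ψ t‖ := by
  refine (sq_eq_sq₀ (norm_nonneg _) (by positivity)).1 ?_
  rw [PiLp.norm_sq_eq_of_L2]
  simp only [featureProduct, norm_smul, mul_pow, Real.norm_eq_abs, sq_abs, ← Finset.sum_mul,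
    e.sum_sq_inner_left]
  ring

theorem continuous_featureProduct [TopologicalSpace T] (e : OrthonormalBasis ι ℝ D) {Φ : T → H}
    {Ψ : T → D} (hΦ : Continuous Φ) (hΨ : Continuous Ψ) :
    Continuous (featureProduct e Φ Ψ) :=
  (PiLp.continuous_toLp 2 _).comp
    (continuous_pi fun _ => (hΨ.inner continuous_const).smul hΦ)

variable [MeasurableSpace T] {ν : Measure T}

theorem integrable_inner_smul [IsProbabilityMeasure ν] {Φ : T → H} {Ψ : T → D} {κ κ' : ℝ}
    (hΦ : StronglyMeasurable Φ) (hκ : ∀ t, ‖Φ t‖ ≤ κ) (hΨ : StronglyMeasurable Ψ)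
    (hκ' : ∀ t, ‖Ψ t‖ ≤ κ') (h : D) : Integrable (fun t => ⟪Ψ t, h⟫ • Φ t) ν :=
  integrable_smul_feature hΦ hκ ((memLp_inner_feature hΨ hκ' h).integrable (by norm_num))

theorem exists_linearMap_integral_inner_smul [IsProbabilityMeasure ν] {Φ : T → H} {Ψ : T → D}
    {κ κ' : ℝ} (hΦ : StronglyMeasurable Φ) (hκ : ∀ t, ‖Φ t‖ ≤ κ) (hΨ : StronglyMeasurable Ψ)
    (hκ' : ∀ t, ‖Ψ t‖ ≤ κ') :
    ∃ X : D →ₗ[ℝ] H, ∀ h, X h = ∫ t, ⟪Ψ t, h⟫ • Φ t ∂ν := by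
  have hi (h) := integrable_inner_smul (ν := ν) hΦ hκ hΨ hκ' h
  refine ⟨⟨⟨fun h => ∫ t, ⟪Ψ t, h⟫ • Φ t ∂ν, fun h h' => ?_⟩, fun r h => ?_⟩, fun h => rfl⟩
  · rw [← integral_add (hi h) (hi h')]
    simp only [inner_add_right, add_smul]
  · simp only [real_inner_smul_right, mul_smul, integral_smul, RingHom.id_apply]

theorem exists_linearMap_sum_inner_smul {m : ℕ} (c : ℝ) (u : Fin m → H) (v : Fin m → D) :
    ∃ X : D →ₗ[ℝ] H, ∀ h, X h = c • ∑ a, ⟪v a, h⟫ • u a := by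
  refine ⟨⟨⟨fun h => c • ∑ a, ⟪v a, h⟫ • u a, fun h h' => ?_⟩, fun r h => ?_⟩, fun h => rfl⟩
  · simp only [inner_add_right, add_smul, Finset.sum_add_distrib, smul_add]
  · simp only [real_inner_smul_right, mul_smul, ← Finset.smul_sum, RingHom.id_apply]
    exact smul_comm _ _ _

theorem norm_sub_integral_le [IsProbabilityMeasure ν] {Z : T → H} {c : ℝ}
    (hc : ∀ t, ‖Z t‖ ≤ c) (t : T) : ‖Z t - ∫ s, Z s ∂ν‖ ≤ 2 * c := by
  have h := norm_integral_le_of_norm_le_const (μ := ν) (ae_of_all _ hc)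
  rw [probReal_univ, mul_one] at h
  linarith [norm_sub_le (Z t) (∫ s, Z s ∂ν), hc t]

theorem norm_mean_sub_integral_le [IsProbabilityMeasure ν] {Z : T → H} {c : ℝ} (hc0 : 0 ≤ c)
    (hc : ∀ t, ‖Z t‖ ≤ c) {m : ℕ} (x : Fin m → T) :
    ‖(m : ℝ)⁻¹ • ∑ i, Z (x i) - ∫ s, Z s ∂ν‖ ≤ 2 * c := by
  have h := norm_integral_le_of_norm_le_const (μ := ν) (ae_of_all _ hc)
  rw [probReal_univ, mul_one] at h
  have h2 : ‖(m : ℝ)⁻¹ • ∑ i, Z (x i)‖ ≤ c := by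
    rw [norm_smul, Real.norm_of_nonneg (by positivity)]
    calc (m : ℝ)⁻¹ * ‖∑ i, Z (x i)‖ ≤ (m : ℝ)⁻¹ * (m * c) := by
          gcongr
          refine (norm_sum_le _ _).trans ((Finset.sum_le_sum fun i _ => hc (x i)).trans_eq ?_)
          simp
      _ = ((m : ℝ) * (m : ℝ)⁻¹) * c := by ring
      _ ≤ 1 * c := by gcongr; exact mul_inv_le_one
      _ = c := one_mul c
  linarith [norm_sub_le ((m : ℝ)⁻¹ • ∑ i, Z (x i)) (∫ s, Z s ∂ν)]

/-- The Hilbert–Schmidt distance between the empirical and the population cross operators. -/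
theorem sum_norm_sq_sub_eq [IsProbabilityMeasure ν] [CompleteSpace H] [CompleteSpace D]
    (e : OrthonormalBasis ι ℝ D) {Φ : T → H} {Ψ : T → D}
    (hZ : Integrable (featureProduct e Φ Ψ) ν) {m : ℕ} (x : Fin m → T) {X X' : D →ₗ[ℝ] H}
    (hX : ∀ h, X h = (m : ℝ)⁻¹ • ∑ a, ⟪Ψ (x a), h⟫ • Φ (x a))
    (hX' : ∀ h, X' h = ∫ t, ⟪Ψ t, h⟫ • Φ t ∂ν) :
    ∑ i, ‖(X - X') (e i)‖ ^ 2 =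
      ‖(m : ℝ)⁻¹ • ∑ a, featureProduct e Φ Ψ (x a) - ∫ t, featureProduct e Φ Ψ t ∂ν‖ ^ 2 := by
  rw [PiLp.norm_sq_eq_of_L2]
  refine Finset.sum_congr rfl fun i _ => ?_
  congr 2
  have h := (PiLp.proj (𝕜 := ℝ) 2 (fun _ : ι => H) i).integral_comp_comm hZ
  simp only [PiLp.proj_apply] at h
  simp only [LinearMap.sub_apply, hX, hX', WithLp.ofLp_sub, WithLp.ofLp_smul, WithLp.ofLp_sum,
    Pi.sub_apply, Pi.smul_apply, Finset.sum_apply, ← h]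
  rfl

end FeatureProduct

section Assembly

theorem abs_sqrt_sub_sqrt_le (a b : ℝ) : |√a - √b| ≤ √|a - b| := by
  wlog h : b ≤ a generalizing a b
  · rw [abs_sub_comm, abs_sub_comm a]
    exact this b a (le_of_not_ge h)
  rw [abs_of_nonneg (sub_nonneg.2 (Real.sqrt_le_sqrt h)), abs_of_nonneg (sub_nonneg.2 h),
    sub_le_iff_le_add]
  have h1 := Real.sqrt_nonneg (a - b)
  rcases le_total 0 b with hb | hb
  · refine Real.sqrt_le_iff.2 ⟨by positivity, ?_⟩
    nlinarith [Real.sq_sqrt hb, Real.sq_sqrt (sub_nonneg.2 h), Real.sqrt_nonneg b]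
  · rw [Real.sqrt_eq_zero_of_nonpos hb, add_zero]
    exact Real.sqrt_le_sqrt (by linarith)

/-- Nuclear norms of two maps on a finite-dimensional space, computed along bases with orthogonal
images. -/
theorem abs_sum_norm_sub_le {H D : Type*} [NormedAddCommGroup H] [InnerProductSpace ℝ H]
    [NormedAddCommGroup D] [InnerProductSpace ℝ D] {ι : Type*} [Fintype ι]
    (X X' : D →ₗ[ℝ] H) (e f f' : OrthonormalBasis ι ℝ D)
    (hf : Pairwise fun i j => ⟪X (f i), X (f j)⟫ = 0)
    (hf' : Pairwise fun i j => ⟪X' (f' i), X' (f' j)⟫ = 0) :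
    |∑ i, ‖X (f i)‖ - ∑ i, ‖X' (f' i)‖| ≤
      √(Fintype.card ι) * √(∑ i, ‖(X - X') (e i)‖ ^ 2) := by
  have h1 := sum_norm_map_sub_le X X' e f f' hf
  have h2 := sum_norm_map_sub_le X' X e f' f hf'
  have h3 : ∑ i, ‖(X' - X) (e i)‖ ^ 2 = ∑ i, ‖(X - X') (e i)‖ ^ 2 := by
    simp only [LinearMap.sub_apply, norm_sub_rev]
  rw [h3] at h2
  exact abs_sub_le_iff.2 ⟨h1, h2⟩

theorem min_two_mul_le {u : ℝ} (hu : 0 ≤ u) : min (2 * u) 2 ≤ √2 * √(u ^ 2 + u) := by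
  rw [← Real.sqrt_mul (by norm_num)]
  refine Real.le_sqrt_of_sq_le ?_
  rcases le_total u 1 with h | h
  · rw [min_eq_left (by linarith)]
    nlinarith
  · rw [min_eq_right (by linarith)]
    nlinarith

theorem abs_sqrt_sub_sqrt_le_of_deviation {s₁ s₂ τ S₁ S₂ τ' κ₁ κ₂ d u h : ℝ} (hκ₁ : 0 < κ₁)
    (hκ₂ : 0 < κ₂) (hu : 0 ≤ u) (h₁ : |s₁ - S₁| ≤ κ₁ ^ 2 * u) (h₂ : |s₂ - S₂| ≤ κ₂ ^ 2 * u)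
    (hτ : |τ - τ'| ≤ √d * h) (hh : h ≤ 2 * (κ₁ * κ₂) * u) (hh' : h ≤ 2 * (κ₁ * κ₂)) :
    |√(s₁ + s₂ - 2 * τ) - √(S₁ + S₂ - 2 * τ')| ≤
      √((κ₁ ^ 2 + κ₂ ^ 2) * (u ^ 2 + u) + 2 * √2 * κ₁ * κ₂ * √d * √(u ^ 2 + u)) := by
  refine (abs_sqrt_sub_sqrt_le _ _).trans (Real.sqrt_le_sqrt ?_)
  have hmin : h ≤ κ₁ * κ₂ * (√2 * √(u ^ 2 + u)) := by
    refine le_trans ?_ (mul_le_mul_of_nonneg_left (min_two_mul_le hu) (by positivity))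
    rw [mul_min_of_nonneg _ _ (by positivity)]
    exact le_min (by linarith) (by linarith)
  have hd := mul_le_mul_of_nonneg_left hmin (Real.sqrt_nonneg d)
  have hsq : 0 ≤ (κ₁ ^ 2 + κ₂ ^ 2) * u ^ 2 := by positivity
  calc |s₁ + s₂ - 2 * τ - (S₁ + S₂ - 2 * τ')|
      = |(s₁ - S₁) + (s₂ - S₂) - 2 * (τ - τ')| := by ring_nf
    _ ≤ |s₁ - S₁| + |s₂ - S₂| + 2 * |τ - τ'| := by
        refine (abs_sub _ _).trans (add_le_add (abs_add_le _ _) (le_of_eq ?_))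
        rw [abs_mul, abs_of_pos (by norm_num : (0 : ℝ) < 2)]
    _ ≤ _ := by linarith

/-- A set whose sections over most points are large is large for the product measure, measurable
or not. -/
theorem le_measure_prod_of_sections {α β : Type*} [MeasurableSpace α] [MeasurableSpace β]
    (μ : Measure α) (ρ : Measure β) [IsProbabilityMeasure μ] [IsProbabilityMeasure ρ]
    (S : Set (α × β)) {p : α → Prop} {a b : ENNReal} (hp : μ {x | ¬p x} ≤ a)
    (hS : ∀ x, p x → ρ {y | (x, y) ∉ S} ≤ b) : 1 - (a + b) ≤ (μ.prod ρ) S := by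
  set S' := toMeasurable (μ.prod ρ) S
  have hS' : MeasurableSet S' := measurableSet_toMeasurable _ _
  set B := toMeasurable μ {x | ¬p x}
  have hB : MeasurableSet B := measurableSet_toMeasurable _ _
  have hcompl : (μ.prod ρ) S'ᶜ ≤ a + b := by
    rw [Measure.prod_apply hS'.compl]
    calc ∫⁻ x, ρ (Prod.mk x ⁻¹' S'ᶜ) ∂μ ≤ ∫⁻ x, (B.indicator 1 x + b) ∂μ := by
          refine lintegral_mono fun x => ?_
          by_cases hx : x ∈ B
          · simp only [hx, Set.indicator_of_mem, Pi.one_apply]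
            exact prob_le_one.trans le_self_add
          · have hxp : p x := by
              by_contra h
              exact hx (subset_toMeasurable μ _ h)
            refine (measure_mono fun y hy => ?_).trans ((hS x hxp).trans le_add_self)
            exact fun h => hy (subset_toMeasurable _ _ h)
      _ = μ B + b := by
          rw [lintegral_add_right _ measurable_const, lintegral_indicator_one hB]
          simp
      _ ≤ a + b := by
          rw [measure_toMeasurable]
          gcongr
  have h := prob_add_prob_compl (μ := μ.prod ρ) hS'
  rw [← measure_toMeasurable, tsub_le_iff_right, ← h]
  gcongr

theorem sqrt_mul_sqrt_le {κ δ m N : ℝ} (hκ : 0 < κ) (hδ0 : 0 < δ) (hδ1 : δ < 1)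
    (hN : 0 < N) {F : ℝ} (hF : F ≤ 192 * κ ^ 4 / (N * δ)) :
    √(√m * √F) ≤ 3 * κ * √(16 / (N * δ ^ 2) + 2 * √m / (√N * δ) * (3 + 8 / (√N * δ))) := by
  have hsN : 0 < √N := Real.sqrt_pos.2 hN
  have h1 : √F ≤ 54 * κ ^ 2 / (√N * δ) := by
    refine Real.sqrt_le_iff.2 ⟨by positivity, hF.trans ?_⟩
    rw [div_pow, mul_pow, mul_pow, Real.sq_sqrt hN.le, ← pow_mul,
      div_le_div_iff₀ (by positivity) (by positivity)]
    have h2 : 192 * δ ≤ 54 ^ 2 := by linarith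
    calc 192 * κ ^ 4 * (N * δ ^ 2) = κ ^ 4 * (N * δ) * (192 * δ) := by ring
      _ ≤ κ ^ 4 * (N * δ) * 54 ^ 2 := by gcongr
      _ = 54 ^ 2 * κ ^ (2 * 2) * (N * δ) := by ring
  rw [show 3 * κ = √((3 * κ) ^ 2) from (Real.sqrt_sq (by positivity)).symm,
    ← Real.sqrt_mul (sq_nonneg (3 * κ))]
  refine Real.sqrt_le_sqrt ?_
  have h3 : 0 ≤ 16 / (N * δ ^ 2) + 2 * √m / (√N * δ) * (8 / (√N * δ)) := by positivity
  calc √m * √F ≤ √m * (54 * κ ^ 2 / (√N * δ)) := by gcongr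
    _ = (3 * κ) ^ 2 * (2 * √m / (√N * δ) * 3) := by ring
    _ ≤ _ := by
        refine mul_le_mul_of_nonneg_left ?_ (sq_nonneg _)
        rw [mul_add]
        linarith

end Assembly
section KernelMatrices

variable {T Ω : Type*} {m N : ℕ}

/-- The kernel matrix `K[X] / m`. -/
def kernelMatrix (K : T → T → ℝ) (x : Fin m → T) : Matrix (Fin m) (Fin m) ℝ :=
  (m : ℝ)⁻¹ • Matrix.of fun a b => K (x a) (x b)

/-- The empirical covariance function of a sample of a random process. -/
def sampleKernel (ξ : Ω → T → ℝ) (W : Fin N → Ω) (s t : T) : ℝ :=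
  (N : ℝ)⁻¹ * ∑ j, ξ (W j) s * ξ (W j) t

theorem posSemidef_kernelMatrix {H : Type*} [NormedAddCommGroup H] [InnerProductSpace ℝ H]
    {K : T → T → ℝ} {Φ : T → H} (hΦ : ∀ s t, ⟪Φ s, Φ t⟫ = K s t) (x : Fin m → T) :
    (kernelMatrix K x).PosSemidef := by
  have h : kernelMatrix K x = (m : ℝ)⁻¹ • Matrix.gram ℝ fun a => Φ (x a) := by
    ext a b
    simp [kernelMatrix, Matrix.gram, hΦ]
  rw [h]
  exact (Matrix.posSemidef_gram ℝ _).smul (by positivity)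

theorem posSemidef_kernelMatrix_sampleKernel (ξ : Ω → T → ℝ) (W : Fin N → Ω) (x : Fin m → T) :
    (kernelMatrix (sampleKernel ξ W) x).PosSemidef := by
  refine posSemidef_kernelMatrix
    (Φ := fun t => WithLp.toLp 2 fun j => √(N : ℝ)⁻¹ * ξ (W j) t) (fun s t => ?_) x
  rw [PiLp.inner_apply, sampleKernel, Finset.mul_sum]
  refine Finset.sum_congr rfl fun j _ => ?_
  have h : √(N : ℝ)⁻¹ * √(N : ℝ)⁻¹ = (N : ℝ)⁻¹ := Real.mul_self_sqrt (by positivity)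
  rw [RCLike.inner_apply, conj_trivial]
  linear_combination (ξ (W j) s * ξ (W j) t) * h

/-- With high probability over the sampled processes, the Wasserstein distance of the sample
covariance matrices is close to that of the kernel matrices. -/
theorem measure_sampleKernel_deviation_le {Ω₁ Ω₂ : Type*} [MeasurableSpace Ω₁]
    [MeasurableSpace Ω₂] {P₁ : Measure Ω₁} [IsProbabilityMeasure P₁] {P₂ : Measure Ω₂}
    [IsProbabilityMeasure P₂] {K₁ K₂ : T → T → ℝ} {κ₁ κ₂ : ℝ} (hκ₁ : 0 < κ₁) (hκ₂ : 0 < κ₂)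
    (hb₁ : ∀ t, K₁ t t ≤ κ₁ ^ 2) (hb₂ : ∀ t, K₂ t t ≤ κ₂ ^ 2)
    (hK₁ : ∀ s t, K₁ s t = K₁ t s) (hK₂ : ∀ s t, K₂ s t = K₂ t s)
    (hpos₁ : ∀ (n : ℕ) (x : Fin n → T) (c : Fin n → ℝ),
      0 ≤ ∑ a, ∑ b, c a * c b * K₁ (x a) (x b))
    (hpos₂ : ∀ (n : ℕ) (x : Fin n → T) (c : Fin n → ℝ),
      0 ≤ ∑ a, ∑ b, c a * c b * K₂ (x a) (x b))
    {ξ₁ : Ω₁ → T → ℝ} {ξ₂ : Ω₂ → T → ℝ}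
    (hξ₁ : ∀ t, Measurable fun ω => ξ₁ ω t) (hξ₂ : ∀ t, Measurable fun ω => ξ₂ ω t)
    (hG₁ : ∀ (n : ℕ) (x : Fin n → T) (a : Fin n → ℝ),
      Measure.map (fun ω => ∑ i, a i * ξ₁ ω (x i)) P₁ =
        gaussianReal 0 (∑ i, ∑ j, a i * a j * K₁ (x i) (x j)).toNNReal)
    (hG₂ : ∀ (n : ℕ) (x : Fin n → T) (a : Fin n → ℝ),
      Measure.map (fun ω => ∑ i, a i * ξ₂ ω (x i)) P₂ =
        gaussianReal 0 (∑ i, ∑ j, a i * a j * K₂ (x i) (x j)).toNNReal)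
    (hN : 0 < N) {δ : ℝ} (hδ0 : 0 < δ) (hδ1 : δ < 1) (x : Fin m → T)
    {S M : Matrix (Fin m) (Fin m) ℝ} (hS : S.PosSemidef) (hSS : S * S = kernelMatrix K₁ x)
    (hM : M.PosSemidef) (hMM : M * M = S * kernelMatrix K₂ x * S) :
    ((Measure.pi fun _ : Fin N => P₁).prod (Measure.pi fun _ : Fin N => P₂))
      {W | ¬ ∀ Q R : Matrix (Fin m) (Fin m) ℝ, Q.PosSemidef →
        Q * Q = kernelMatrix (sampleKernel ξ₁ W.1) x → R.PosSemidef →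
        R * R = Q * kernelMatrix (sampleKernel ξ₂ W.2) x * Q →
        |√((kernelMatrix (sampleKernel ξ₁ W.1) x).trace +
            (kernelMatrix (sampleKernel ξ₂ W.2) x).trace - 2 * R.trace) -
          √((kernelMatrix K₁ x).trace + (kernelMatrix K₂ x).trace - 2 * M.trace)| ≤
        3 * (κ₁ + κ₂) *
          √(16 / (N * δ ^ 2) + 2 * √m / (√N * δ) * (3 + 8 / (√N * δ)))} ≤
      ENNReal.ofReal (δ / 2) := by
  have hN' : (0 : ℝ) < N := by exact_mod_cast hN
  obtain ⟨Φ₂, hΦ₂⟩ := exists_feature_of_gaussian hK₂ hpos₂ hξ₂ hG₂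
  have hprob {κ : ℝ} (hκ : 0 < κ) :
      48 * κ ^ 4 / (N * (192 * κ ^ 4 / (N * δ))) = δ / 4 := by
    field_simp
    norm_num
  have h₁ := measure_sum_sq_sampleCovariance_sub_ge_le hκ₁ hb₁ hK₁ hpos₁ hξ₁ hG₁ hN x
    (r := 192 * κ₁ ^ 4 / (N * δ)) (by positivity)
  have h₂ := measure_sum_sq_sampleCovariance_sub_ge_le hκ₂ hb₂ hK₂ hpos₂ hξ₂ hG₂ hN x
    (r := 192 * κ₂ ^ 4 / (N * δ)) (by positivity)
  rw [hprob hκ₁] at h₁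
  rw [hprob hκ₂] at h₂
  set B₁ := {W : Fin N → Ω₁ | 192 * κ₁ ^ 4 / (N * δ) ≤ ∑ a, ∑ b,
      ((m : ℝ)⁻¹ * ((N : ℝ)⁻¹ * ∑ j, ξ₁ (W j) (x a) * ξ₁ (W j) (x b)) -
        (m : ℝ)⁻¹ * K₁ (x a) (x b)) ^ 2}
  set B₂ := {W : Fin N → Ω₂ | 192 * κ₂ ^ 4 / (N * δ) ≤ ∑ a, ∑ b,
      ((m : ℝ)⁻¹ * ((N : ℝ)⁻¹ * ∑ j, ξ₂ (W j) (x a) * ξ₂ (W j) (x b)) -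
        (m : ℝ)⁻¹ * K₂ (x a) (x b)) ^ 2}
  calc _ ≤ ((Measure.pi fun _ : Fin N => P₁).prod (Measure.pi fun _ : Fin N => P₂))
        (B₁ ×ˢ Set.univ ∪ Set.univ ×ˢ B₂) := by
        refine measure_mono fun W hW => ?_
        by_contra hgood
        simp only [Set.mem_union, Set.mem_prod, Set.mem_univ, and_true, true_and, not_or] at hgood
        refine hW fun Q R hQ hQQ hR hRR => ?_
        obtain ⟨hF₁, hF₂⟩ := hgood
        simp only [B₁, B₂, Set.mem_ofPred_eq, not_le] at hF₁ hF₂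
        have h := abs_sqrt_bures_sub_le (posSemidef_kernelMatrix_sampleKernel ξ₂ W.2 x)
          (posSemidef_kernelMatrix hΦ₂ x) hQ hQQ hR hRR hS hSS hM hMM
        refine h.trans (le_of_le_of_eq (add_le_add
          (sqrt_mul_sqrt_le hκ₁ hδ0 hδ1 hN' hF₁.le) (sqrt_mul_sqrt_le hκ₂ hδ0 hδ1 hN' hF₂.le)) ?_)
        ring
    _ ≤ ENNReal.ofReal (δ / 4) + ENNReal.ofReal (δ / 4) := by
        refine (measure_union_le _ _).trans (add_le_add ?_ ?_)
        · rwa [Measure.prod_prod, measure_univ, mul_one]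
        · rwa [Measure.prod_prod, measure_univ, one_mul]
    _ = ENNReal.ofReal (δ / 2) := by
        rw [← ENNReal.ofReal_add (by positivity) (by positivity)]
        congr 1
        ring

/-- With high probability over the sampled points, the Wasserstein distance of the kernel matrices
is close to that of the covariance operators. -/
theorem measure_kernelMatrix_deviation_le [TopologicalSpace T] [SecondCountableTopology T]
    [MeasurableSpace T] [OpensMeasurableSpace T] [TopologicalSpace.PseudoMetrizableSpace T]
    {ν : Measure T} [IsProbabilityMeasure ν]
    {H D : Type*} [NormedAddCommGroup H] [InnerProductSpace ℝ H] [CompleteSpace H]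
    [NormedAddCommGroup D] [InnerProductSpace ℝ D] [FiniteDimensional ℝ D] {K₁ K₂ : T → T → ℝ}
    (hc₁ : Continuous fun p : T × T => K₁ p.1 p.2) (hc₂ : Continuous fun p : T × T => K₂ p.1 p.2)
    {κ₁ κ₂ : ℝ} (hκ₁ : 0 < κ₁) (hκ₂ : 0 < κ₂)
    (hb₁ : ∀ t, K₁ t t ≤ κ₁ ^ 2) (hb₂ : ∀ t, K₂ t t ≤ κ₂ ^ 2)
    {Φ : T → H} {Ψ : T → D} (hΦ : ∀ s t, ⟪Φ s, Φ t⟫ = K₁ s t) (hΨ : ∀ s t, ⟪Ψ s, Ψ t⟫ = K₂ s t)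
    {C₁ C₂ Q R : Lp ℝ 2 ν →L[ℝ] Lp ℝ 2 ν}
    (hC₁ : ∀ f : Lp ℝ 2 ν, ⇑(C₁ f) =ᵐ[ν] fun x => ∫ t, K₁ x t * f t ∂ν)
    (hC₂ : ∀ f : Lp ℝ 2 ν, ⇑(C₂ f) =ᵐ[ν] fun x => ∫ t, K₂ x t * f t ∂ν)
    (hQ : Q.IsPositive) (hQQ : Q ∘L Q = C₁) (hR : R.IsPositive) (hRR : R ∘L R = Q ∘L C₂ ∘L Q)
    {ι : Type*} (e : HilbertBasis ι ℝ (Lp ℝ 2 ν)) (hm : 0 < m) {u : ℝ} (hu : 0 ≤ u) :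
    (Measure.pi fun _ : Fin m => ν)
      {x | ¬ ∀ S M : Matrix (Fin m) (Fin m) ℝ, S.PosSemidef → S * S = kernelMatrix K₁ x →
        M.PosSemidef → M * M = S * kernelMatrix K₂ x * S →
        |√((kernelMatrix K₁ x).trace + (kernelMatrix K₂ x).trace - 2 * M.trace) -
          √((∑' k, ⟪e k, C₁ (e k)⟫) + (∑' k, ⟪e k, C₂ (e k)⟫) - 2 * ∑' k, ⟪e k, R (e k)⟫)| ≤
        √((κ₁ ^ 2 + κ₂ ^ 2) * (u ^ 2 + u) +
          2 * √2 * κ₁ * κ₂ * √(Module.finrank ℝ D) * √(u ^ 2 + u))} ≤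
      3 * ENNReal.ofReal (2 * Real.exp (-(m * u ^ 2 / 2))) := by
  have hΦc := continuous_of_inner_eq hc₁ hΦ
  have hΨc := continuous_of_inner_eq hc₂ hΨ
  have hΦκ (t) : ‖Φ t‖ ≤ κ₁ := by
    rw [← sq_le_sq₀ (norm_nonneg _) hκ₁.le, ← real_inner_self_eq_norm_sq, hΦ]
    exact hb₁ t
  have hΨκ (t) : ‖Ψ t‖ ≤ κ₂ := by
    rw [← sq_le_sq₀ (norm_nonneg _) hκ₂.le, ← real_inner_self_eq_norm_sq, hΨ]
    exact hb₂ t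
  have hΦm := hΦc.stronglyMeasurable
  have hΨm := hΨc.stronglyMeasurable
  let b := stdOrthonormalBasis ℝ D
  obtain ⟨X', hX'⟩ := exists_linearMap_integral_inner_smul (ν := ν) hΦm hΦκ hΨm hΨκ
  obtain ⟨f', hf'⟩ := exists_orthonormalBasis_map_orthogonal rfl X'
  have hZm := (continuous_featureProduct b hΦc hΨc).stronglyMeasurable
  have hZκ (t) : ‖featureProduct b Φ Ψ t‖ ≤ κ₁ * κ₂ := by
    rw [norm_featureProduct]
    exact mul_le_mul (hΦκ t) (hΨκ t) (norm_nonneg _) hκ₁.le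
  have hZi : Integrable (featureProduct b Φ Ψ) ν :=
    Integrable.of_bound hZm.aestronglyMeasurable _ (ae_of_all _ hZκ)
  have hdiag {K : T → T → ℝ} {κ : ℝ} (hκ : 0 < κ) (hb : ∀ t, K t t ≤ κ ^ 2)
      (h0 : ∀ t, 0 ≤ K t t) (hc : Continuous fun p : T × T => K p.1 p.2) :
      (Measure.pi fun _ : Fin m => ν)
        {x | κ ^ 2 * u ≤ ‖(m : ℝ)⁻¹ • ∑ i, K (x i) (x i) - ∫ t, K t t ∂ν‖} ≤
        ENNReal.ofReal (2 * Real.exp (-(m * u ^ 2 / 2))) := by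
    have hmeas : StronglyMeasurable fun t => K t t :=
      (hc.comp (continuous_id.prodMk continuous_id)).stronglyMeasurable
    have hi : Integrable (fun t => K t t) ν :=
      Integrable.of_bound hmeas.aestronglyMeasurable (κ ^ 2) (ae_of_all _ fun t => by
        rw [Real.norm_of_nonneg (h0 t)]
        exact hb t)
    refine measure_norm_mean_sub_ge_le hmeas hi (by positivity) (fun t => ?_) hm hu
    have h1 : 0 ≤ ∫ t, K t t ∂ν := integral_nonneg h0
    have h2 : ∫ t, K t t ∂ν ≤ κ ^ 2 := by
      simpa using integral_mono hi (integrable_const (κ ^ 2)) hb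
    rw [Real.norm_eq_abs, abs_le]
    constructor <;> linarith [hb t, h0 t]
  have h₁ := hdiag hκ₁ hb₁ (fun t => hΦ t t ▸ real_inner_self_nonneg) hc₁
  have h₂ := hdiag hκ₂ hb₂ (fun t => hΨ t t ▸ real_inner_self_nonneg) hc₂
  have h₃ := measure_norm_mean_sub_ge_le hZm hZi (c := 2 * (κ₁ * κ₂)) (by positivity)
    (norm_sub_integral_le hZκ) hm hu
  refine (measure_mono fun x hx => ?_).trans (((measure_union_le _ _).trans (add_le_add
    ((measure_union_le _ _).trans (add_le_add h₁ h₂)) h₃)).trans_eq (by ring))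
  by_contra hgood
  simp only [Set.mem_union, Set.mem_ofPred_eq, not_or, not_le] at hgood
  refine hx fun S M hS hSS hM hMM => ?_
  obtain ⟨X, hX⟩ := exists_linearMap_sum_inner_smul (m : ℝ)⁻¹ (fun a => Φ (x a)) fun a => Ψ (x a)
  obtain ⟨f, hf⟩ := exists_orthonormalBasis_map_orthogonal rfl X
  have hτ := abs_sum_norm_sub_le X X' b f f' hf hf'
  rw [sum_norm_sq_sub_eq b hZi x hX hX', Real.sqrt_sq (norm_nonneg _), Fintype.card_fin,
    ← trace_sqrt_conj_eq_sum_norm (by positivity) (fun a => Φ (x a)) (fun a => Ψ (x a))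
      (fun a c => by rw [hΦ]; rfl) (fun a c => by rw [hΨ]; rfl) hS hSS hM hMM X hX f hf,
    ← tsum_inner_sqrt_covariance hΦm hΦκ hΨm hΨκ hΦ hΨ hC₁ hC₂ hQ hQQ hR hRR e X' hX' f' hf'] at hτ
  have htr (K : T → T → ℝ) :
      (kernelMatrix K x).trace = (m : ℝ)⁻¹ • ∑ i, K (x i) (x i) := by
    simp [kernelMatrix, Matrix.trace, Finset.mul_sum]
  rw [htr, htr, tsum_inner_covariance hΦc hΦκ hΦ hC₁ e, tsum_inner_covariance hΨc hΨκ hΨ hC₂ e]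
  exact abs_sqrt_sub_sqrt_le_of_deviation hκ₁ hκ₂ hu hgood.1.1.le hgood.1.2.le hτ hgood.2.le
    (norm_mean_sub_integral_le (by positivity) hZκ x)

end KernelMatrices

theorem wasserstein_estimation_from_finite_samples
    {T : Type*} [MetricSpace T] [SigmaCompactSpace T] [MeasurableSpace T] [BorelSpace T]
    (ν : Measure T) [IsProbabilityMeasure ν]
    (K1 K2 : T → T → ℝ)
    (hK1cont : Continuous fun p : T × T => K1 p.1 p.2)
    (hK2cont : Continuous fun p : T × T => K2 p.1 p.2)
    (hK1symm : ∀ s t, K1 s t = K1 t s) (hK2symm : ∀ s t, K2 s t = K2 t s)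
    (hK1pos : ∀ (n : ℕ) (x : Fin n → T) (c : Fin n → ℝ),
      0 ≤ ∑ a, ∑ b, c a * c b * K1 (x a) (x b))
    (hK2pos : ∀ (n : ℕ) (x : Fin n → T) (c : Fin n → ℝ),
      0 ≤ ∑ a, ∑ b, c a * c b * K2 (x a) (x b))
    (κ1 κ2 : ℝ) (hκ1 : 0 < κ1) (hκ2 : 0 < κ2)
    (hbound1 : ∀ x, K1 x x ≤ κ1 ^ 2) (hbound2 : ∀ x, K2 x x ≤ κ2 ^ 2)
    {H2 : Type*} [NormedAddCommGroup H2] [InnerProductSpace ℝ H2] [CompleteSpace H2]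
    [FiniteDimensional ℝ H2]
    (Φ2 : T → H2) (hΦ2 : ∀ s t, ⟪Φ2 s, Φ2 t⟫ = K2 s t)
    (hdense2 : (Submodule.span ℝ (Set.range Φ2)).topologicalClosure = ⊤)
    (C1 C2 : Lp ℝ 2 ν →L[ℝ] Lp ℝ 2 ν)
    (hC1 : ∀ f : Lp ℝ 2 ν, ⇑(C1 f) =ᵐ[ν] fun x => ∫ t, K1 x t * f t ∂ν)
    (hC2 : ∀ f : Lp ℝ 2 ν, ⇑(C2 f) =ᵐ[ν] fun x => ∫ t, K2 x t * f t ∂ν)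
    {ιL : Type*} [Countable ιL] (eL : HilbertBasis ιL ℝ (Lp ℝ 2 ν))
    (sqC1 : Lp ℝ 2 ν →L[ℝ] Lp ℝ 2 ν)
    (hsqC1 : sqC1.IsPositive ∧ sqC1 ∘L sqC1 = C1)
    (SM : Lp ℝ 2 ν →L[ℝ] Lp ℝ 2 ν)
    (hSM : SM.IsPositive ∧ SM ∘L SM = sqC1 ∘L C2 ∘L sqC1)
    {Ω1 Ω2 : Type*} [MeasurableSpace Ω1] [MeasurableSpace Ω2]
    (P1 : Measure Ω1) [IsProbabilityMeasure P1]
    (P2 : Measure Ω2) [IsProbabilityMeasure P2]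
    (ξ1 : Ω1 → T → ℝ) (ξ2 : Ω2 → T → ℝ)
    (hmeas1 : ∀ t, Measurable fun ω => ξ1 ω t) (hmeas2 : ∀ t, Measurable fun ω => ξ2 ω t)
    (hGauss1 : ∀ (n : ℕ) (x : Fin n → T) (a : Fin n → ℝ),
      Measure.map (fun ω => ∑ i, a i * ξ1 ω (x i)) P1 =
        gaussianReal 0 (∑ i, ∑ j, a i * a j * K1 (x i) (x j)).toNNReal)
    (hGauss2 : ∀ (n : ℕ) (x : Fin n → T) (a : Fin n → ℝ),
      Measure.map (fun ω => ∑ i, a i * ξ2 ω (x i)) P2 =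
        gaussianReal 0 (∑ i, ∑ j, a i * a j * K2 (x i) (x j)).toNNReal)
    (m : ℕ) (hm : 0 < m) (N : ℕ) (hN : 0 < N)
    (δ : ℝ) (hδ0 : 0 < δ) (hδ1 : δ < 1) :
    ENNReal.ofReal (1 - δ) ≤
      ((Measure.pi fun _ : Fin m => ν).prod
          ((Measure.pi fun _ : Fin N => P1).prod (Measure.pi fun _ : Fin N => P2)))
        {XW : (Fin m → T) × ((Fin N → Ω1) × (Fin N → Ω2)) |
          ∀ Q1 QM : Matrix (Fin m) (Fin m) ℝ,
            Q1.PosSemidef →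
            Q1 * Q1 = (m : ℝ)⁻¹ • Matrix.of (fun a b =>
              (N : ℝ)⁻¹ * ∑ j, ξ1 (XW.2.1 j) (XW.1 a) * ξ1 (XW.2.1 j) (XW.1 b)) →
            QM.PosSemidef →
            QM * QM = Q1 * ((m : ℝ)⁻¹ • Matrix.of (fun a b =>
              (N : ℝ)⁻¹ * ∑ j, ξ2 (XW.2.2 j) (XW.1 a) * ξ2 (XW.2.2 j) (XW.1 b))) * Q1 →
            |Real.sqrt
                (((m : ℝ)⁻¹ • Matrix.of (fun a b =>
                    (N : ℝ)⁻¹ * ∑ j, ξ1 (XW.2.1 j) (XW.1 a) * ξ1 (XW.2.1 j) (XW.1 b))).trace +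
                  ((m : ℝ)⁻¹ • Matrix.of (fun a b =>
                    (N : ℝ)⁻¹ * ∑ j, ξ2 (XW.2.2 j) (XW.1 a) * ξ2 (XW.2.2 j) (XW.1 b))).trace -
                  2 * QM.trace) -
              Real.sqrt
                ((∑' k, ⟪(eL k : Lp ℝ 2 ν), C1 (eL k)⟫) +
                  (∑' k, ⟪(eL k : Lp ℝ 2 ν), C2 (eL k)⟫) -
                  2 * ∑' k, ⟪(eL k : Lp ℝ 2 ν), SM (eL k)⟫)| ≤
            Real.sqrt
                ((κ1 ^ 2 + κ2 ^ 2) *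
                    (2 * Real.log (12 / δ) / m + Real.sqrt (2 * Real.log (12 / δ) / m)) +
                  2 * Real.sqrt 2 * κ1 * κ2 * Real.sqrt (Module.finrank ℝ H2) *
                    Real.sqrt (2 * Real.log (12 / δ) / m +
                      Real.sqrt (2 * Real.log (12 / δ) / m))) +
              3 * (κ1 + κ2) *
                Real.sqrt (16 / (N * δ ^ 2) +
                  2 * Real.sqrt m / (Real.sqrt N * δ) * (3 + 8 / (Real.sqrt N * δ))) } := by
  have hm' : (0 : ℝ) < m := by exact_mod_cast hm
  obtain ⟨Φ1, hΦ1⟩ := exists_feature_of_gaussian hK1symm hK1pos hmeas1 hGauss1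
  set u := √(2 * Real.log (12 / δ) / m) with hu
  have hlog : 0 ≤ Real.log (12 / δ) :=
    Real.log_nonneg ((one_le_div hδ0).2 (by linarith))
  have husq : u ^ 2 = 2 * Real.log (12 / δ) / m := Real.sq_sqrt (by positivity)
  have hexp : 2 * Real.exp (-(m * u ^ 2 / 2)) = δ / 6 := by
    rw [husq, show (m : ℝ) * (2 * Real.log (12 / δ) / m) / 2 = Real.log (12 / δ) by field_simp,
      Real.exp_neg, Real.exp_log (by positivity)]
    field_simp
    norm_num
  have hpop := measure_kernelMatrix_deviation_le hK1cont hK2cont hκ1 hκ2 hbound1 hbound2 hΦ1 hΦ2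
    hC1 hC2 hsqC1.1 hsqC1.2 hSM.1 hSM.2 eL hm (Real.sqrt_nonneg (2 * Real.log (12 / δ) / m))
  rw [← hu, hexp, husq] at hpop
  have htotal : ENNReal.ofReal (1 - δ) ≤
      1 - (3 * ENNReal.ofReal (δ / 6) + ENNReal.ofReal (δ / 2)) := by
    rw [show (3 : ENNReal) = ENNReal.ofReal 3 by simp, ← ENNReal.ofReal_mul (by norm_num),
      ← ENNReal.ofReal_add (by positivity) (by positivity), ENNReal.ofReal_sub _ hδ0.le,
      ENNReal.ofReal_one, show 3 * (δ / 6) + δ / 2 = δ by ring]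
  refine htotal.trans (le_measure_prod_of_sections _ _ _ hpop fun x hx => ?_)
  obtain ⟨S, hS, hSS⟩ := (posSemidef_kernelMatrix hΦ1 x).exists_sq_eq
  have hconj : (S * kernelMatrix K2 x * S).PosSemidef := by
    have h := (posSemidef_kernelMatrix hΦ2 x).mul_mul_conjTranspose_same S
    rwa [hS.1.eq] at h
  obtain ⟨M, hM, hMM⟩ := hconj.exists_sq_eq
  have hx' := hx S M hS hSS hM hMM
  refine (measure_mono fun W hW => ?_).trans
    (measure_sampleKernel_deviation_le hκ1 hκ2 hbound1 hbound2 hK1symm hK2symm hK1pos hK2pos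
      hmeas1 hmeas2 hGauss1 hGauss2 hN hδ0 hδ1 x hS hSS hM hMM)
  intro hgood
  refine hW fun Q1 QM hQ1 hQQ hQM hMQ => ?_
  have h := hgood Q1 QM hQ1 hQQ hQM hMQ
  exact (abs_sub_le _ _ _).trans ((add_le_add h hx').trans_eq (add_comm _ _))

end
end

section
/- Let H be a real separable Hilbert space and A, B self-adjoint positive trace-class operators on H. Then the operators −I + (I+A)^{1/2} and −I + (I+B)^{1/2} are trace class, and | tr(−I + (I+A)^{1/2}) − tr(−I + (I+B)^{1/2}) | ≤ (1/2) ‖A − B‖_tr. -/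
/- STATEMENT 16: For self-adjoint positive trace-class operators `A, B` on a real separable
Hilbert space `H`, the operators `−I + (I+A)^{1/2}` and `−I + (I+B)^{1/2}` are trace class and
`|tr(−I + (I+A)^{1/2}) − tr(−I + (I+B)^{1/2})| ≤ (1/2) ‖A − B‖_tr`.

Encoding: the positive trace-class (hence compact self-adjoint) operator `A` (resp. `B`) is
diagonalized by a Hilbert basis `e` (resp. `f`) with nonnegative summable eigenvalues `lam`
(resp. `mu`), supplied as hypotheses. In this eigenbasis, `−I + (I+A)^{1/2}` is the positive
operator with eigenvalues `√(1+lam k) − 1`; it is trace class iff `k ↦ √(1+lam k) − 1` is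
summable, in which case its trace is `∑' k, (√(1+lam k) − 1)`. The trace norm of the
self-adjoint operator `A − B` is `∑' k, ⟪g k, S (g k)⟫` for a Hilbert basis `g`, where `S`
is the (unique) positive square root of `(A−B)* ∘ (A−B)`, i.e. `S = |A−B|`. -/

open scoped RealInnerProductSpace

noncomputable section

open Module.End in
/-- A compact symmetric operator on a real Hilbert space is diagonalized by a Hilbert basis. -/
theorem IsCompactOperator.exists_hilbertBasis_apply_eq_smul.{u}
    {H : Type u} [NormedAddCommGroup H] [InnerProductSpace ℝ H] [CompleteSpace H]
    {T : H →L[ℝ] H} (hT : IsCompactOperator T) (hT' : T.IsSymmetric) :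
    ∃ (ι : Type u) (b : HilbertBasis ι ℝ H) (d : ι → ℝ), ∀ i, T (b i) = d i • b i := by
  have hclosed (μ : ℝ) : IsClosed (eigenspace (T : Module.End ℝ H) μ : Set H) := by
    have : (eigenspace (T : Module.End ℝ H) μ : Set H) = {x | T x = μ • x} := by
      ext x
      simp
    rw [this]
    exact isClosed_eq T.continuous (continuous_const_smul μ)
  have hcomplete (μ : ℝ) : CompleteSpace (eigenspace (T : Module.End ℝ H) μ) :=
    (hclosed μ).completeSpace_coe
  choose w v _ using fun μ : ℝ => exists_hilbertBasis ℝ (eigenspace (T : Module.End ℝ H) μ)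
  have hon := hT'.orthogonalFamily_eigenspaces.orthonormal_sigma_orthonormal
    fun μ => (v μ).orthonormal
  refine ⟨Σ μ, w μ, HilbertBasis.mkOfOrthogonalEqBot hon ?_, fun a => a.1, fun a => ?_⟩
  · rw [Submodule.eq_bot_iff]
    intro x hx
    rw [← Submodule.mem_bot ℝ,
      ← ContinuousLinearMap.orthogonalComplement_iSup_eigenspaces_eq_bot hT hT',
      ← Submodule.iInf_orthogonal, Submodule.mem_iInf]
    intro μ y hy
    have h := (v μ).hasSum_repr ⟨y, hy⟩
    have h2 := (h.mapL (Submodule.subtypeL _)).mapL (innerSL ℝ x)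
    have h3 (i : w μ) : inner ℝ x (v μ i : H) = 0 := by
      rw [real_inner_comm]
      exact hx _ (Submodule.subset_span ⟨⟨μ, i⟩, rfl⟩)
    rw [real_inner_comm]
    simpa using h2.unique (by simp [h3, hasSum_zero])
  · simpa using mem_eigenspace_iff.mp (v a.1 a.2).2

namespace HilbertBasis

variable {H : Type*} [NormedAddCommGroup H] [InnerProductSpace ℝ H] {ι κ : Type*}

/-- An operator diagonalized by a Hilbert basis with summable eigenvalues is compact. -/
theorem isCompactOperator_of_summable [CompleteSpace H] (e : HilbertBasis ι ℝ H) {T : H →L[ℝ] H}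
    {a : ι → ℝ} (hT : ∀ i, T (e i) = a i • e i) (ha : Summable a) : IsCompactOperator T := by
  have hsum : Summable fun i => a i • InnerProductSpace.rankOne ℝ (e i) (e i) := by
    refine Summable.of_norm ?_
    simpa [norm_smul, e.orthonormal.1] using ha.abs
  have heq : ∑' i, a i • InnerProductSpace.rankOne ℝ (e i) (e i) = T := by
    ext x
    have h := hsum.hasSum.mapL (ContinuousLinearMap.apply ℝ H x)
    refine h.unique ?_
    convert (e.hasSum_repr x).mapL T using 1
    ext i
    simp [hT, e.repr_apply_apply, smul_smul, mul_comm]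
  refine isCompactOperator_of_tendsto (heq ▸ hsum.hasSum) (Filter.Eventually.of_forall fun s => ?_)
  refine (compactOperator (RingHom.id ℝ) H H).sum_mem fun i _ => ?_
  refine Submodule.smul_mem _ _ ?_
  exact (isCompactOperator_of_locallyCompactSpace_dom (innerSL ℝ (e i))).clm_comp
    (ContinuousLinearMap.toSpanSingleton ℝ (e i))

theorem hasSum_sq_inner (e : HilbertBasis ι ℝ H) (x : H) :
    HasSum (fun i => inner ℝ (e i) x ^ 2) (‖x‖ ^ 2) := by
  convert! e.hasSum_inner_mul_inner x x using 1
  · funext i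
    rw [real_inner_comm (e i) x, sq]
  · exact (real_inner_self_eq_norm_sq x).symm

/-- The squared overlaps of two Hilbert bases form a doubly stochastic matrix. -/
theorem hasSum_mul_sq_inner (e : HilbertBasis ι ℝ H) (f : HilbertBasis κ ℝ H) {a : ι → ℝ}
    (ha : Summable a) :
    HasSum (fun p : κ × ι => a p.2 * inner ℝ (e p.2) (f p.1) ^ 2) (∑' i, a i) := by
  have hrow (c : ℝ) (i : ι) : HasSum (fun k => c * inner ℝ (e i) (f k) ^ 2) c := by
    simpa [real_inner_comm, e.orthonormal.1] using (f.hasSum_sq_inner (e i)).mul_left c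
  have hs : Summable fun p : ι × κ => a p.1 * inner ℝ (e p.1) (f p.2) ^ 2 := by
    rw [← summable_abs_iff, summable_prod_of_nonneg fun p => abs_nonneg _]
    simp only [abs_mul, abs_sq]
    refine ⟨fun i => (hrow _ i).summable, ?_⟩
    simpa only [(hrow _ _).tsum_eq] using ha.abs
  have h := hs.hasSum
  rw [← (h.prod_fiberwise fun i => hrow (a i) i).tsum_eq] at h
  exact (Equiv.prodComm κ ι).hasSum_iff.mpr h

theorem hasSum_inner_apply_self (e : HilbertBasis ι ℝ H) {T : H →L[ℝ] H} (hT' : T.IsSymmetric)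
    {a : ι → ℝ} (hT : ∀ i, T (e i) = a i • e i) (x : H) :
    HasSum (fun i => a i * inner ℝ (e i) x ^ 2) (inner ℝ x (T x)) := by
  convert! e.hasSum_inner_mul_inner x (T x) using 1
  funext i
  have h : inner ℝ (e i) (T x) = a i * inner ℝ (e i) x := by
    rw [← real_inner_smul_left, ← hT]
    exact (hT' (e i) x).symm
  rw [h, real_inner_comm (e i) x]
  ring

/-- The trace of a diagonalizable operator is the sum of its eigenvalues, in any Hilbert basis. -/
theorem hasSum_inner_apply (e : HilbertBasis ι ℝ H) (f : HilbertBasis κ ℝ H) {T : H →L[ℝ] H}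
    (hT' : T.IsSymmetric) {a : ι → ℝ} (hT : ∀ i, T (e i) = a i • e i) (ha : Summable a) :
    HasSum (fun k => inner ℝ (f k) (T (f k))) (∑' i, a i) :=
  (e.hasSum_mul_sq_inner f ha).prod_fiberwise fun k => e.hasSum_inner_apply_self hT' hT (f k)

end HilbertBasis

/-- If `S` is positive and `S ^ 2 = T ^ 2`, then eigenvectors of `T` for `d` are eigenvectors
of `S` for `|d|`. -/
theorem ContinuousLinearMap.IsPositive.apply_eq_abs_smul
    {H : Type*} [NormedAddCommGroup H] [InnerProductSpace ℝ H]
    {S T : H →L[ℝ] H} (hS : S.IsPositive) (hST : S ∘L S = T ∘L T) {d : ℝ} {x : H}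
    (hx : T x = d • x) : S x = |d| • x := by
  have hSS : S (S x) = (|d| * |d|) • x := by
    have := DFunLike.congr_fun hST x
    simpa [hx, smul_smul] using this
  rcases eq_or_ne d 0 with rfl | hd
  · have h := hS.inner_left_eq_inner_right x (S x)
    rw [hSS] at h
    simpa using h
  · have hy : S (S x - |d| • x) = -|d| • (S x - |d| • x) := by
      rw [map_sub, map_smul, hSS]
      module
    have h := hS.inner_nonneg_right (S x - |d| • x)
    rw [hy, inner_smul_right, real_inner_self_eq_norm_sq] at h
    have hpos : 0 < |d| := abs_pos.mpr hd
    have : ‖S x - |d| • x‖ ^ 2 ≤ 0 := by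
      by_contra! hc
      nlinarith [mul_pos hpos hc]
    rw [← sub_eq_zero, ← norm_eq_zero]
    exact pow_eq_zero_iff two_ne_zero |>.mp (this.antisymm (sq_nonneg _))

theorem Real.sqrt_one_add_le_tangent {x y : ℝ} (hx : 0 ≤ x) (hy : 0 ≤ y) :
    √(1 + x) ≤ √(1 + y) + (2 * √(1 + y))⁻¹ * (x - y) := by
  have h1 := Real.sq_sqrt (show 0 ≤ 1 + x by positivity)
  have h2 := Real.sq_sqrt (show 0 ≤ 1 + y by positivity)
  have h3 : 0 < √(1 + y) := by positivity
  rw [← sub_nonneg]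
  have : √(1 + y) + (2 * √(1 + y))⁻¹ * (x - y) - √(1 + x) =
      (√(1 + x) - √(1 + y)) ^ 2 / (2 * √(1 + y)) := by
    field_simp
    nlinarith
  rw [this]
  positivity

theorem Summable.sqrt_one_add_sub_one {ι : Type*} {a : ι → ℝ} (ha : Summable a)
    (h : ∀ i, 0 ≤ a i) : Summable fun i => √(1 + a i) - 1 := by
  refine Summable.of_nonneg_of_le (fun i => ?_) (fun i => ?_) ha
  · rw [sub_nonneg, Real.one_le_sqrt]
    linarith [h i]
  · have := Real.sqrt_one_add_le_tangent (h i) le_rfl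
    norm_num at this
    linarith [h i]

/-- Peierls-type inequality: comparison of the trace of `√(1 + T) - 1` with a sequence `b` close to
the diagonal of `T` in a Hilbert basis. -/
theorem HilbertBasis.tsum_sqrt_one_add_sub_one_sub_le
    {H : Type*} [NormedAddCommGroup H] [InnerProductSpace ℝ H] {ι κ : Type*}
    (e : HilbertBasis ι ℝ H) (f : HilbertBasis κ ℝ H) {T : H →L[ℝ] H} (hT' : T.IsSymmetric)
    {a : ι → ℝ} {b c : κ → ℝ} {s : ℝ} (ha0 : ∀ i, 0 ≤ a i) (hb0 : ∀ k, 0 ≤ b k)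
    (hT : ∀ i, T (e i) = a i • e i) (ha : Summable a) (hb : Summable b)
    (hc : ∀ k, |inner ℝ (f k) (T (f k)) - b k| ≤ c k) (hs : HasSum c s) :
    ∑' i, (√(1 + a i) - 1) - ∑' k, (√(1 + b k) - 1) ≤ 1 / 2 * s := by
  have hprod := e.hasSum_mul_sq_inner f (ha.sqrt_one_add_sub_one ha0)
  have hfiber := hprod.prod_fiberwise fun k => (hprod.summable.prod_factor k).hasSum
  rw [sub_le_iff_le_add']
  refine hasSum_le (fun k => ?_) hfiber
    ((hb.sqrt_one_add_sub_one hb0).hasSum.add (hs.mul_left (1 / 2)))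
  have hone : HasSum (fun i => inner ℝ (e i) (f k) ^ 2) 1 := by
    simpa [f.orthonormal.1] using e.hasSum_sq_inner (f k)
  set m := (2 * √(1 + b k))⁻¹ with hm
  have hm0 : 0 ≤ m := by positivity
  have hm1 : m ≤ 1 / 2 := by
    rw [hm, one_div]
    gcongr
    have : 1 ≤ √(1 + b k) := by
      rw [Real.one_le_sqrt]
      linarith [hb0 k]
    linarith
  have hbound := (hone.mul_left (√(1 + b k) - 1 - m * b k)).add
    ((e.hasSum_inner_apply_self hT' hT (f k)).mul_left m)
  calc _ ≤ (√(1 + b k) - 1 - m * b k) * 1 + m * inner ℝ (f k) (T (f k)) := by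
        refine hasSum_le (fun i => ?_) (hprod.summable.prod_factor k).hasSum hbound
        have h := mul_le_mul_of_nonneg_right (Real.sqrt_one_add_le_tangent (ha0 i) (hb0 k))
          (sq_nonneg (inner ℝ (e i) (f k)))
        dsimp only
        linear_combination h
    _ = √(1 + b k) - 1 + m * (inner ℝ (f k) (T (f k)) - b k) := by ring
    _ ≤ √(1 + b k) - 1 + m * c k := by
        gcongr
        exact (le_abs_self _).trans (hc k)
    _ ≤ _ := by
        gcongr
        exact (abs_nonneg _).trans (hc k)

theorem trace_neg_id_add_sqrt_one_add_diff_le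
    {H : Type*} [NormedAddCommGroup H] [InnerProductSpace ℝ H] [CompleteSpace H]
    {ι κι γ : Type*} [Countable ι] [Countable κι] [Countable γ]
    (e : HilbertBasis ι ℝ H) (f : HilbertBasis κι ℝ H) (g : HilbertBasis γ ℝ H)
    (A B : H →L[ℝ] H) (hA : A.IsPositive) (hB : B.IsPositive)
    (lam : ι → ℝ) (mu : κι → ℝ)
    (hlam : ∀ k, 0 ≤ lam k) (hmu : ∀ k, 0 ≤ mu k)
    (hAe : ∀ k, A (e k) = lam k • (e k : H))
    (hBf : ∀ k, B (f k) = mu k • (f k : H))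
    (hAtr : Summable lam) (hBtr : Summable mu)
    (S : H →L[ℝ] H)
    (hS : S.IsPositive ∧ S ∘L S = (A - B).adjoint ∘L (A - B)) :
    (Summable fun k => Real.sqrt (1 + lam k) - 1) ∧
    (Summable fun k => Real.sqrt (1 + mu k) - 1) ∧
    |(∑' k, (Real.sqrt (1 + lam k) - 1)) - ∑' k, (Real.sqrt (1 + mu k) - 1)| ≤
      (1 / 2) * ∑' k, ⟪(g k : H), S (g k)⟫ := by
  have hAs : A.IsSymmetric := hA.isSymmetric
  have hBs : B.IsSymmetric := hB.isSymmetric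
  have hD : (A - B).IsSymmetric := hAs.sub hBs
  obtain ⟨hSpos, hSS⟩ := hS
  rw [hD.isSelfAdjoint.adjoint_eq] at hSS
  obtain ⟨τ, b, d, hb⟩ := IsCompactOperator.exists_hilbertBasis_apply_eq_smul
    (T := A - B) ((e.isCompactOperator_of_summable hAe hAtr).sub
      (f.isCompactOperator_of_summable hBf hBtr)) hD
  have hSb (i : τ) : S (b i) = |d i| • b i := hSpos.apply_eq_abs_smul hSS (hb i)
  have hd : Summable fun i => |d i| := by
    refine Summable.of_nonneg_of_le (fun i => abs_nonneg _) (fun i => ?_)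
      ((e.hasSum_inner_apply b hAs hAe hAtr).add (f.hasSum_inner_apply b hBs hBf hBtr)).summable
    have hdi : d i = ⟪b i, A (b i)⟫ - ⟪b i, B (b i)⟫ := by
      rw [← inner_sub_right, ← sub_apply, hb, inner_smul_right,
        real_inner_self_eq_norm_sq, b.orthonormal.1]
      simp
    have h1 := hA.inner_nonneg_right (b i)
    have h2 := hB.inner_nonneg_right (b i)
    rw [hdi, abs_le]
    constructor <;> linarith
  have hle (x : H) : |⟪x, (A - B) x⟫| ≤ ⟪x, S x⟫ := by
    have h1 := b.hasSum_inner_apply_self hD hb x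
    have h2 := b.hasSum_inner_apply_self hSpos.isSymmetric hSb x
    rw [abs_le]
    refine ⟨hasSum_le (fun i => ?_) h2.neg h1, hasSum_le (fun i => ?_) h1 h2⟩
    · rw [← neg_mul]
      gcongr
      exact neg_abs_le _
    · gcongr
      exact le_abs_self _
  refine ⟨hAtr.sqrt_one_add_sub_one hlam, hBtr.sqrt_one_add_sub_one hmu, ?_⟩
  rw [(b.hasSum_inner_apply g hSpos.isSymmetric hSb hd).tsum_eq, abs_le, neg_le, neg_sub]
  constructor
  · refine f.tsum_sqrt_one_add_sub_one_sub_le e hBs hmu hlam hBf hBtr hAtr (fun k => ?_)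
      (b.hasSum_inner_apply e hSpos.isSymmetric hSb hd)
    have h := hle (e k)
    rw [sub_apply, inner_sub_right, hAe, inner_smul_right,
      real_inner_self_eq_norm_sq, e.orthonormal.1, abs_sub_comm] at h
    simpa using h
  · refine e.tsum_sqrt_one_add_sub_one_sub_le f hAs hlam hmu hAe hAtr hBtr (fun k => ?_)
      (b.hasSum_inner_apply f hSpos.isSymmetric hSb hd)
    have h := hle (f k)
    rw [sub_apply, inner_sub_right, hBf, inner_smul_right,
      real_inner_self_eq_norm_sq, f.orthonormal.1] at h
    simpa using h

end
end
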